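/- arXiv:2106.12148 — 2 statements merged into one kernel-verified Lean document; each statement's English description precedes it below -/
import Mathlib

section
/- Let n ≥ 6 be an even integer with n ≠ 10. Then every almost self-centered graph of order n has girth at most 4⌊n/6⌋. -/
open SimpleGraph

/-- The eccentricity of a vertex `v`: the maximum distance from `v` to any vertex. -/
noncomputable def graphEcc {V : Type*} [Fintype V] (G : SimpleGraph V) (v : V) : ℕ :=
  Finset.univ.sup fun u => G.dist v u

/-- The radius of a graph: the minimum eccentricity over all vertices. -/
noncomputable def graphRadius {V : Type*} [Fintype V] (G : SimpleGraph V) : ℕ :=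
  sInf (Set.range (graphEcc G))

/-- The diameter of a graph: the maximum eccentricity over all vertices. -/
noncomputable def graphDiam {V : Type*} [Fintype V] (G : SimpleGraph V) : ℕ :=
  Finset.univ.sup (graphEcc G)

/-- A connected graph of order `n` is almost self-centered if it has exactly `n - 2`
central vertices (vertices whose eccentricity equals the radius). -/
def IsAlmostSelfCentered {V : Type*} [Fintype V] (G : SimpleGraph V) : Prop :=
  G.Connected ∧ Nat.card {v : V | graphEcc G v = graphRadius G} = Fintype.card V - 2

/-- A connected graph of order `n` is almost peripheral if it has exactly `n - 1`
peripheral vertices (vertices whose eccentricity equals the diameter). -/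
def IsAlmostPeripheral {V : Type*} [Fintype V] (G : SimpleGraph V) : Prop :=
  G.Connected ∧ Nat.card {v : V | graphEcc G v = graphDiam G} = Fintype.card V - 1



namespace ASC

variable {V : Type*} {G : SimpleGraph V}

/-- An injective sequence of vertices `f 0, …, f n` with consecutive ones adjacent. -/
def Arc (G : SimpleGraph V) (f : ℕ → V) (n : ℕ) : Prop :=
  (∀ i < n, G.Adj (f i) (f (i + 1))) ∧ ∀ i ≤ n, ∀ j ≤ n, f i = f j → i = j

theorem walk_of_seq (f : ℕ → V) (n : ℕ) (h : ∀ i < n, G.Adj (f i) (f (i + 1))) :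
    ∃ w : G.Walk (f 0) (f n), w.length = n ∧ w.support = (List.range (n + 1)).map f ∧
      w.edges = (List.range n).map (fun i => s(f i, f (i + 1))) := by
  induction n with
  | zero => exact ⟨Walk.nil, by simp⟩
  | succ n ih =>
    obtain ⟨w, h1, h2, h3⟩ := ih (fun i hi => h i (by omega))
    refine ⟨w.concat (h n (by omega)), ?_, ?_, ?_⟩
    · simp [h1]
    · rw [Walk.support_concat, h2, List.range_succ (n := n + 1)]; simp
    · rw [Walk.edges_concat, h3, List.range_succ (n := n)]; simp

theorem dist_seq_le (f : ℕ → V) (n : ℕ) (h : ∀ i < n, G.Adj (f i) (f (i + 1))) :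
    ∀ i j, i ≤ j → j ≤ n → G.dist (f i) (f j) ≤ j - i := by
  intro i j hij hj
  obtain ⟨w, h1, -⟩ := walk_of_seq (G := G) (fun m => f (i + m)) (j - i)
    (fun m hm => by simpa [add_assoc] using h (i + m) (by omega))
  have h2 := dist_le w
  rw [h1] at h2
  simpa [Nat.add_sub_cancel' hij] using h2

theorem egirth_le_of_closed (f : ℕ → V) (n : ℕ) (hn : 2 ≤ n) (h : Arc G f n)
    (hc : G.Adj (f n) (f 0)) : G.egirth ≤ ((n + 1 : ℕ) : ℕ∞) := by
  obtain ⟨h1, h2⟩ := h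
  obtain ⟨w, hl, hs, he⟩ := walk_of_seq f n h1
  have hp : w.IsPath := by
    rw [Walk.isPath_def, hs]
    refine List.Nodup.map_on ?_ List.nodup_range
    intro a ha b hb hab
    simp at ha hb
    exact h2 a (by omega) b (by omega) hab
  have hcyc : (Walk.cons hc w).IsCycle := by
    rw [Walk.cons_isCycle_iff]
    refine ⟨hp, ?_⟩
    rw [he]
    simp only [List.mem_map, List.mem_range, not_exists, not_and]
    intro i hi heq
    rw [Sym2.eq_iff] at heq
    rcases heq with ⟨a, b⟩ | ⟨a, b⟩
    · have := h2 _ (by omega) _ (by omega) a; omega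
    · have := h2 _ (by omega) _ (by omega) a
      have := h2 _ (by omega) _ (by omega) b; omega
  have := egirth_le_length hcyc
  simpa [hl] using this

/-- every cycle has length at least `g`, in terms of closed arcs -/
def GirthGE (G : SimpleGraph V) (g : ℕ) : Prop :=
  ∀ (f : ℕ → V) (n : ℕ), 2 ≤ n → Arc G f n → G.Adj (f n) (f 0) → g ≤ n + 1

theorem girthGE_of_not (g : ℕ) (h : ¬ G.egirth ≤ (g : ℕ∞)) : GirthGE G (g + 1) := by
  intro f n hn hf hc
  by_contra hlt
  apply h
  refine (egirth_le_of_closed f n hn hf hc).trans ?_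
  exact_mod_cast (by omega : n + 1 ≤ g)

theorem nb_repeat (t : ℕ → V) (ha : ∀ n, G.Adj (t n) (t (n + 1))) (hb : ∀ n, t (n + 2) ≠ t n)
    (i j : ℕ) (hij : i < j) (he : t i = t j) :
    ∃ a l, 2 ≤ l ∧ l + 1 ≤ j - i ∧ Arc G (fun m => t (a + m)) l ∧ t (a + l + 1) = t a := by
  classical
  have hex : ∃ l, 0 < l ∧ ∃ a, t (a + l) = t a :=
    ⟨j - i, by omega, i, by rw [Nat.add_sub_cancel' hij.le, he]⟩
  obtain ⟨h0, a, hal⟩ := Nat.find_spec hex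
  have hmin := fun m (hm : m < Nat.find hex) => Nat.find_min hex hm
  have hle : Nat.find hex ≤ j - i :=
    Nat.find_min' hex ⟨by omega, i, by rw [Nat.add_sub_cancel' hij.le, he]⟩
  generalize Nat.find hex = l at *
  have hl1 : l ≠ 1 := by
    rintro rfl
    exact (ha a).ne hal.symm
  have hl2 : l ≠ 2 := by
    rintro rfl
    exact hb a hal
  have key : ∀ p q, p < q → q < l → t (a + p) ≠ t (a + q) := by
    intro p q hpq hq heq
    exact hmin (q - p) (by omega) ⟨by omega, a + p, by
      rw [show a + p + (q - p) = a + q by omega, heq]⟩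
  refine ⟨a, l - 1, by omega, by omega, ⟨fun m _ => by simpa [add_assoc] using ha (a + m), ?_⟩, ?_⟩
  · intro p hp q hq heq
    rcases lt_trichotomy p q with h | h | h
    · exact absurd heq (key p q h (by omega))
    · exact h
    · exact absurd heq.symm (key q p h (by omega))
  · rw [show a + (l - 1) + 1 = a + l by omega, hal]

theorem nb_girth {g : ℕ} (hg : GirthGE G g) (t : ℕ → V) (ha : ∀ n, G.Adj (t n) (t (n + 1)))
    (hb : ∀ n, t (n + 2) ≠ t n) (i j : ℕ) (hij : i < j) (he : t i = t j) : g ≤ j - i := by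
  obtain ⟨a, l, h1, h2, h3, h4⟩ := nb_repeat t ha hb i j hij he
  have := hg _ l h1 h3 (by
    have := ha (a + l)
    rw [h4] at this
    simpa using this)
  omega

theorem nb_exists (S : Set V) (hS : ∀ a ∈ S, ∀ b ∈ S, G.Adj a b → ∃ c ∈ S, G.Adj b c ∧ c ≠ a)
    (a b : V) (ha : a ∈ S) (hb : b ∈ S) (hab : G.Adj a b) :
    ∃ t : ℕ → V, t 0 = a ∧ t 1 = b ∧ (∀ n, t n ∈ S) ∧ (∀ n, G.Adj (t n) (t (n + 1))) ∧
      ∀ n, t (n + 2) ≠ t n := by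
  classical
  let D := {p : V × V // p.1 ∈ S ∧ p.2 ∈ S ∧ G.Adj p.1 p.2}
  have hstep : ∀ p : D, ∃ q : D, q.1.1 = p.1.2 ∧ q.1.2 ≠ p.1.1 := by
    rintro ⟨⟨p, q⟩, h1, h2, h3⟩
    obtain ⟨c, hc, h4, h5⟩ := hS p h1 q h2 h3
    exact ⟨⟨⟨q, c⟩, h2, hc, h4⟩, rfl, h5⟩
  choose nx hn1 hn2 using hstep
  let s : ℕ → D := fun n => nx^[n] ⟨⟨a, b⟩, ha, hb, hab⟩
  have hs : ∀ n, s (n + 1) = nx (s n) := fun n => Function.iterate_succ_apply' nx n _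
  have h1 : ∀ n, (s (n + 1)).1.1 = (s n).1.2 := fun n => by rw [hs, hn1]
  refine ⟨fun n => (s n).1.1, rfl, h1 0, fun n => (s n).2.1, fun n => ?_, fun n => ?_⟩
  · simp only [h1]; exact (s n).2.2.2
  · simp only [h1]; rw [hs]; exact hn2 _

theorem pigeon [Fintype V] (t : ℕ → V) (A : Finset V) (b : ℕ)
    (h : ∀ i, b ≤ i → i ≤ b + A.card → t i ∈ A) :
    ∃ i j, b ≤ i ∧ i < j ∧ j ≤ b + A.card ∧ t i = t j := by
  have := Finset.exists_ne_map_eq_of_card_lt_of_maps_to (s := Finset.Icc b (b + A.card)) (t := A)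
    (f := t) (by simp; omega) (fun i hi => by
      simp at hi; exact h i hi.1 hi.2)
  obtain ⟨i, hi, j, hj, hne, he⟩ := this
  simp at hi hj
  rcases lt_or_gt_of_ne hne with h | h
  · exact ⟨i, j, hi.1, h, hj.2, he⟩
  · exact ⟨j, i, hj.1, h, hi.2, he.symm⟩

/-- The ear lemma. -/
theorem ear [Fintype V] {g : ℕ} (hg : GirthGE G g) (S : Set V)
    (hS : ∀ a ∈ S, ∀ b ∈ S, G.Adj a b → ∃ c ∈ S, G.Adj b c ∧ c ≠ a)
    (A : Finset V) (hA : Fintype.card V + 1 < A.card + g) (s t : V) (hs : s ∈ S) (ht : t ∈ S)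
    (hst : G.Adj s t) :
    ∃ (q : ℕ → V) (m : ℕ), 1 ≤ m ∧ Arc G q m ∧ q 0 = s ∧ q 1 = t ∧ (∀ i, q i ∈ S) ∧ q m ∈ A ∧
      (∀ i, 0 < i → i < m → q i ∉ A) := by
  classical
  obtain ⟨q, h0, h1, hqS, ha, hb⟩ := nb_exists S hS s t hs ht hst
  have hcard : (Aᶜ).card = Fintype.card V - A.card := Finset.card_compl A
  have hle : A.card ≤ Fintype.card V := Finset.card_le_univ A
  have hex : ∃ m, 1 ≤ m ∧ m ≤ (Aᶜ).card + 1 ∧ q m ∈ A := by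
    by_contra hno
    push Not at hno
    obtain ⟨i, j, hi, hij, hj, he⟩ := pigeon q Aᶜ 1 (fun i h1 h2 => by
      simpa using hno i h1 (by omega))
    have := nb_girth hg q ha hb i j hij he
    omega
  obtain ⟨h2, h3, h4⟩ := Nat.find_spec hex
  have hmin := fun m (hm : m < Nat.find hex) => Nat.find_min hex hm
  generalize Nat.find hex = m at *
  refine ⟨q, m, h2, ⟨fun i _ => ha i, ?_⟩, h0, h1, hqS, h4, ?_⟩
  · intro i hi j hj he
    rcases lt_trichotomy i j with h | h | h
    · have := nb_girth hg q ha hb i j h he; omega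
    · exact h
    · have := nb_girth hg q ha hb j i h he.symm; omega
  · intro i hi him hiA
    exact hmin i him ⟨hi, by omega, hiA⟩

/-- Initial cycle, as a periodic sequence. -/
theorem exists_cycle [Fintype V] {g : ℕ} (hg : GirthGE G g) (S : Set V)
    (hS : ∀ a ∈ S, ∀ b ∈ S, G.Adj a b → ∃ c ∈ S, G.Adj b c ∧ c ≠ a)
    (a b : V) (ha : a ∈ S) (hb : b ∈ S) (hab : G.Adj a b) :
    ∃ (z : ℕ → V) (L : ℕ), 3 ≤ L ∧ g ≤ L ∧ (∀ i, z i ∈ S) ∧ (∀ i, G.Adj (z i) (z (i + 1))) ∧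
      (∀ i, z (i + L) = z i) ∧ (∀ i < L, ∀ j < L, z i = z j → i = j) := by
  classical
  obtain ⟨q, h0, h1, hqS, ha, hb⟩ := nb_exists S hS a b ha hb hab
  obtain ⟨i, j, hi, hij, hj, he⟩ := pigeon q Finset.univ 0 (fun i _ _ => by simp)
  obtain ⟨a, l, h2, h3, h4, h5⟩ := nb_repeat q ha hb i j hij he
  have hcl : G.Adj (q (a + l)) (q (a + 0)) := by
    have := ha (a + l)
    rw [h5] at this
    simpa using this
  refine ⟨fun i => q (a + i % (l + 1)), l + 1, by omega, hg _ l h2 h4 hcl, fun i => hqS _,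
    fun i => ?_, fun i => by simp, ?_⟩
  · have hlt : i % (l + 1) < l + 1 := Nat.mod_lt _ (by omega)
    by_cases hc : i % (l + 1) = l
    · have : (i + 1) % (l + 1) = 0 := by
        rw [Nat.add_mod, hc]
        rw [Nat.mod_eq_of_lt (show 1 < l + 1 by omega), Nat.mod_self]
      simp only [this, hc]
      exact hcl
    · have : (i + 1) % (l + 1) = i % (l + 1) + 1 := by
        rw [Nat.add_mod, Nat.mod_eq_of_lt (show 1 < l + 1 by omega), Nat.mod_eq_of_lt]
        omega
      simp only [this]
      exact ha (a + i % (l + 1))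
  · intro i hi j hj he
    simp only [Nat.mod_eq_of_lt hi, Nat.mod_eq_of_lt hj] at he
    exact h4.2 i (by omega) j (by omega) he

/-- Two internally disjoint arcs with the same ends form a cycle. -/
theorem close_arcs {g : ℕ} (hg : GirthGE G g) (f f' : ℕ → V) (n n' : ℕ) (hf : Arc G f n)
    (hf' : Arc G f' n') (h0 : f 0 = f' 0) (h1 : f n = f' n') (hn : 3 ≤ n + n') (hp : 1 ≤ n')
    (hd : ∀ i ≤ n, ∀ j ≤ n', f i = f' j → (i = 0 ∧ j = 0) ∨ (i = n ∧ j = n')) :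
    g ≤ n + n' := by
  have := hg (fun i => if i ≤ n then f i else f' (n + n' - i)) (n + n' - 1) (by omega) ⟨?_, ?_⟩ ?_
  · omega
  · intro i hi
    by_cases h : i + 1 ≤ n
    · simp only [h, if_true, show i ≤ n by omega]
      exact hf.1 i (by omega)
    · by_cases h' : i ≤ n
      · have : i = n := by omega
        subst this
        simp only [le_refl, if_true, show ¬ (i + 1 ≤ i) by omega, if_false]
        rw [h1]
        have := (hf'.1 (n' - 1) (by omega)).symm
        rw [show n' - 1 + 1 = n' by omega] at this
        rw [show i + n' - (i + 1) = n' - 1 by omega]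
        exact this
      · simp only [h, h', if_false]
        have := (hf'.1 (n + n' - (i + 1)) (by omega)).symm
        rw [show n + n' - (i + 1) + 1 = n + n' - i by omega] at this
        exact this
  · intro i hi j hj he
    by_cases h : i ≤ n <;> by_cases h' : j ≤ n <;> simp only [h, h', if_true, if_false] at he
    · exact hf.2 i h j h' he
    · have := hd i h _ (by omega) he; omega
    · have := hd j h' _ (by omega) he.symm; omega
    · have := hf'.2 _ (by omega) _ (by omega) he; omega
  · simp only [Nat.zero_le, if_true]
    by_cases h : n + n' - 1 ≤ n
    · simp only [h, if_true]
      have : n' = 1 := by omega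
      subst this
      simp only [Nat.add_sub_cancel]
      rw [h1, h0]
      exact (hf'.1 0 (by omega)).symm
    · simp only [h, if_false]
      rw [show n + n' - (n + n' - 1) = 1 by omega, h0]
      exact (hf'.1 0 (by omega)).symm

theorem Arc.rev {f : ℕ → V} {n : ℕ} (h : Arc G f n) : Arc G (fun i => f (n - i)) n := by
  refine ⟨fun i hi => ?_, fun i hi j hj he => ?_⟩
  · have := (h.1 (n - (i + 1)) (by omega)).symm
    rwa [show n - (i + 1) + 1 = n - i by omega] at this
  · have := h.2 _ (by omega) _ (by omega) he
    omega

theorem Arc.sub {f : ℕ → V} {n : ℕ} (h : Arc G f n) (a m : ℕ) (hm : a + m ≤ n) :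
    Arc G (fun i => f (a + i)) m := by
  refine ⟨fun i hi => ?_, fun i hi j hj he => ?_⟩
  · exact h.1 (a + i) (by omega)
  · have := h.2 _ (by omega) _ (by omega) he
    omega

theorem Arc.cat {f f' : ℕ → V} {n n' : ℕ} (h : Arc G f n) (h' : Arc G f' n') (he : f n = f' 0)
    (hd : ∀ i ≤ n, ∀ j ≤ n', f i = f' j → i = n ∧ j = 0) :
    Arc G (fun i => if i ≤ n then f i else f' (i - n)) (n + n') := by
  refine ⟨fun i hi => ?_, fun i hi j hj he => ?_⟩
  · by_cases h1 : i + 1 ≤ n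
    · simp only [h1, if_true, show i ≤ n by omega]
      exact h.1 i (by omega)
    · by_cases h2 : i ≤ n
      · have : i = n := by omega
        subst this
        simp only [le_refl, if_true, show ¬ (i + 1 ≤ i) by omega, if_false]
        rw [he, show i + 1 - i = 0 + 1 by omega]
        exact h'.1 0 (by omega)
      · simp only [h1, h2, if_false]
        rw [show i + 1 - n = i - n + 1 by omega]
        exact h'.1 _ (by omega)
  · by_cases h1 : i ≤ n <;> by_cases h2 : j ≤ n <;> simp only [h1, h2, if_true, if_false] at he
    · exact h.2 i h1 j h2 he
    · have := hd i h1 _ (by omega) he; omega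
    · have := hd j h2 _ (by omega) he.symm; omega
    · have := h'.2 _ (by omega) _ (by omega) he; omega

end ASC


namespace ASC

variable {V : Type*} {G : SimpleGraph V}

/-- Consequences of being almost self-centered. -/
structure Ctx (G : SimpleGraph V) (x y : V) (r : ℕ) : Prop where
  conn : G.Connected
  dxy : G.dist x y = r + 1
  le : ∀ s t, G.dist s t ≤ r ∨ (s = x ∧ t = y) ∨ (s = y ∧ t = x)
  ecc : ∀ s, s ≠ x → s ≠ y → ∃ t, G.dist s t = r

theorem Ctx.symm {x y : V} {r : ℕ} (h : Ctx G x y r) : Ctx G y x r :=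
  ⟨h.conn, by rw [dist_comm, h.dxy], fun s t => by have := h.le s t; tauto,
    fun s h1 h2 => h.ecc s h2 h1⟩

theorem Ctx.ne {x y : V} {r : ℕ} (h : Ctx G x y r) : x ≠ y := by
  rintro rfl
  have := h.dxy
  simp at this

theorem exists_ctx [Fintype V] (h6 : 6 ≤ Fintype.card V) (h : IsAlmostSelfCentered G) :
    ∃ x y r, Ctx G x y r := by
  classical
  obtain ⟨hc, hcard⟩ := h
  have hle : ∀ u v, G.dist u v ≤ graphEcc G u := fun u v =>
    Finset.le_sup (f := fun t => G.dist u t) (Finset.mem_univ v)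
  have hat : ∀ u, ∃ v, G.dist u v = graphEcc G u := by
    intro u
    obtain ⟨v, -, hv⟩ := Finset.exists_mem_eq_sup (Finset.univ : Finset V) ⟨u, Finset.mem_univ u⟩
      (fun t => G.dist u t)
    exact ⟨v, hv.symm⟩
  have hrad : ∀ u, graphRadius G ≤ graphEcc G u := fun u => Nat.sInf_le ⟨u, rfl⟩
  set r := graphRadius G with hr
  have hcard2 : (Finset.univ.filter fun v => ¬ graphEcc G v = r).card = 2 := by
    have h1 : (Finset.univ.filter fun v => graphEcc G v = r).card = Fintype.card V - 2 := by
      rw [← hcard, Nat.card_eq_fintype_card, Fintype.card_ofFinset]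
      congr 1
    have h2 := Finset.card_filter_add_card_filter_not (s := (Finset.univ : Finset V))
      (fun v => graphEcc G v = r)
    rw [Finset.card_univ] at h2
    omega
  obtain ⟨x, y, hxy, hset⟩ := Finset.card_eq_two.mp hcard2
  have hmem : ∀ v, ¬ graphEcc G v = r ↔ v = x ∨ v = y := by
    intro v
    have : v ∈ (Finset.univ.filter fun v => ¬ graphEcc G v = r) ↔ v ∈ ({x, y} : Finset V) := by
      rw [hset]
    simpa using this
  have hcen : ∀ v, v ≠ x → v ≠ y → graphEcc G v = r := by
    intro v h1 h2
    by_contra h3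
    rcases (hmem v).1 h3 with h | h <;> contradiction
  have hge : r + 1 ≤ G.dist x y := by
    have h1 : ¬ graphEcc G x = r := (hmem x).2 (Or.inl rfl)
    have h2 := hrad x
    obtain ⟨t, ht⟩ := hat x
    have h3 : ¬ graphEcc G t = r := by
      have := hle t x
      rw [dist_comm] at this
      omega
    rcases (hmem t).1 h3 with h | h
    · subst h
      simp at ht
      omega
    · subst h
      omega
  have hle' : G.dist x y ≤ r + 1 := by
    have : ∃ w, G.Adj x w := by
      have : Nontrivial V := ⟨x, y, hxy⟩
      exact hc.preconnected.exists_adj_of_nontrivial x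
    obtain ⟨w, hw⟩ := this
    have h1 : G.dist x w = 1 := dist_eq_one_iff_adj.2 hw
    by_cases hwy : w = y
    · subst hwy; omega
    · have h2 := hcen w hw.ne' hwy
      have h3 := hle w y
      have h4 := hc.dist_triangle (u := x) (v := w) (w := y)
      omega
  refine ⟨x, y, r, hc, by omega, ?_, ?_⟩
  · intro s t
    by_cases hs : s = x ∨ s = y
    · by_cases ht : t = x ∨ t = y
      · rcases hs with rfl | rfl <;> rcases ht with rfl | rfl <;> simp
      · push Not at ht
        have := hle t s
        rw [dist_comm, hcen t ht.1 ht.2] at this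
        exact Or.inl this
    · push Not at hs
      have := hle s t
      rw [hcen s hs.1 hs.2] at this
      exact Or.inl this
  · intro s h1 h2
    obtain ⟨t, ht⟩ := hat s
    exact ⟨t, by rw [ht, hcen s h1 h2]⟩

theorem exists_adj_dist (hc : G.Connected) {v w : V} (h : v ≠ w) :
    ∃ a, G.Adj v a ∧ G.dist v w = G.dist a w + 1 := by
  obtain ⟨p, hp⟩ := hc.exists_walk_length_eq_dist v w
  cases p with
  | nil => exact absurd rfl h
  | cons hadj q =>
    refine ⟨_, hadj, ?_⟩
    have h1 := dist_le q
    rename_i b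
    have h3 := hc.dist_triangle (u := v) (v := b) (w := w)
    have h4 : G.dist v b = 1 := dist_eq_one_iff_adj.2 hadj
    simp at hp
    omega

/-- The non-leaves. -/
def Core (G : SimpleGraph V) : Set V := {v | ∃ a b, a ≠ b ∧ G.Adj v a ∧ G.Adj v b}

theorem leaf_unique {v a b : V} (hv : v ∉ Core G) (ha : G.Adj v a) (hb : G.Adj v b) : a = b := by
  by_contra h
  exact hv ⟨a, b, h, ha, hb⟩

theorem leaf_dist (hc : G.Connected) {v v' w : V} (hv : v ∉ Core G) (ha : G.Adj v v')
    (hw : v ≠ w) : G.dist v w = G.dist v' w + 1 := by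
  obtain ⟨a, h1, h2⟩ := exists_adj_dist hc hw
  rw [leaf_unique hv ha h1, h2]

theorem Ctx.leaf_eq {x y : V} {r : ℕ} (h : Ctx G x y r) (hr : 2 ≤ r) {v : V} (hv : v ∉ Core G) :
    v = x ∨ v = y := by
  have : Nontrivial V := ⟨x, y, h.ne⟩
  obtain ⟨a, ha⟩ := h.conn.preconnected.exists_adj_of_nontrivial v
  have h1 : ∃ t, r ≤ G.dist a t := by
    by_cases hx : a = x
    · exact ⟨y, by rw [hx, h.dxy]; omega⟩
    by_cases hy : a = y
    · exact ⟨x, by rw [hy, dist_comm, h.dxy]; omega⟩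
    obtain ⟨t, ht⟩ := h.ecc a hx hy
    exact ⟨t, ht.ge⟩
  obtain ⟨t, ht⟩ := h1
  have hne : v ≠ t := by
    rintro rfl
    have : G.dist a v = 1 := dist_eq_one_iff_adj.2 ha.symm
    omega
  have h2 := leaf_dist h.conn hv ha hne
  rcases h.le v t with h3 | h3 | h3
  · omega
  · exact Or.inl h3.1
  · exact Or.inr h3.1

theorem Ctx.core_two_aux [Fintype V] {x y : V} {r : ℕ} (h : Ctx G x y r) (hr : 2 ≤ r)
    (h6 : 6 ≤ Fintype.card V) {b : V} (hb : b ∈ Core G) (hx : x ∉ Core G) (hbx : G.Adj b x) :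
    ∃ a ∈ Core G, ∃ c ∈ Core G, a ≠ c ∧ G.Adj b a ∧ G.Adj b c := by
  classical
  by_contra hno
  push Not at hno
  have hbx1 : G.dist b x = 1 := dist_eq_one_iff_adj.2 hbx
  have hcore : ∀ a, G.Adj b a → a ≠ x → a ∈ Core G := by
    intro a ha hax
    by_contra hac
    rcases h.leaf_eq hr hac with rfl | rfl
    · exact hax rfl
    · have h1 : G.dist b a = 1 := dist_eq_one_iff_adj.2 ha
      have h2 := h.conn.dist_triangle (u := x) (v := b) (w := a)
      rw [dist_comm, hbx1] at hbx1
      rw [G.dist_comm (u := x) (v := b)] at h2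
      have := h.dxy
      have h3 : G.dist b x = 1 := dist_eq_one_iff_adj.2 hbx
      omega
  have hex : ∃ a, G.Adj b a ∧ a ≠ x := by
    obtain ⟨p, q, hpq, hp, hq⟩ := hb
    by_cases hpx : p = x
    · exact ⟨q, hq, fun hqx => hpq (hpx.trans hqx.symm)⟩
    · exact ⟨p, hp, hpx⟩
  obtain ⟨c, hbc, hcx⟩ := hex
  have honly : ∀ a, G.Adj b a → a = x ∨ a = c := by
    intro a ha
    by_contra hcon
    push Not at hcon
    exact hno a (hcore a ha hcon.1) c (hcore c hbc hcx) hcon.2 ha hbc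
  have d1 : ∀ w, w ≠ x → G.dist x w = G.dist b w + 1 := fun w hw =>
    leaf_dist h.conn hx hbx.symm hw.symm
  have d2 : ∀ w, w ≠ x → w ≠ b → G.dist b w = G.dist c w + 1 := by
    intro w hw hwb
    obtain ⟨a, h1, h2⟩ := exists_adj_dist h.conn hwb.symm
    rcases honly a h1 with rfl | rfl
    · have := d1 w hw; omega
    · exact h2
  have hbx0 : b ≠ x := hbx.ne
  have hby : b ≠ y := by
    rintro rfl
    have := h.dxy
    rw [dist_comm] at this
    omega
  have hxy := h.ne
  have e1 := d1 y hxy.symm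
  have e2 := d2 y hxy.symm hby.symm
  have e3 := h.dxy
  have hcy : c ≠ y := by
    intro hcy
    have hbc1 : G.dist b c = 1 := dist_eq_one_iff_adj.2 hbc
    rw [hcy] at hbc1
    omega
  obtain ⟨w, hw⟩ := h.ecc c hcx hcy
  have hcb1 : G.dist c b = 1 := dist_eq_one_iff_adj.2 hbc.symm
  have hr2 : r = 2 := by
    by_cases hwx : w = x
    · subst hwx
      have := h.conn.dist_triangle (u := c) (v := b) (w := w)
      omega
    by_cases hwb : w = b
    · subst hwb; omega
    have := d2 w hwx hwb
    have h3 := d1 w hwx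
    rcases h.le b w with h4 | h4 | h4
    · omega
    · exact absurd h4.1 hbx0
    · exact absurd h4.1 hby
  have hall : ∀ w : V, w ∈ ({x, b, c, y} : Finset V) := by
    intro w
    simp only [Finset.mem_insert, Finset.mem_singleton]
    by_contra hcon
    push Not at hcon
    obtain ⟨h1, h2, h3, h4⟩ := hcon
    have f1 := d1 w h1
    have f2 := d2 w h1 h2
    have f3 := h.conn.pos_dist_of_ne h3.symm
    rcases h.le x w with f4 | f4 | f4
    · omega
    · exact h4 f4.2
    · exact h1 f4.2
  have : Fintype.card V ≤ 4 := by
    rw [← Finset.card_univ]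
    calc Finset.univ.card ≤ ({x, b, c, y} : Finset V).card :=
          Finset.card_le_card (fun w _ => hall w)
      _ ≤ 4 := Finset.card_le_four
  omega

theorem Ctx.core_two [Fintype V] {x y : V} {r : ℕ} (h : Ctx G x y r) (hr : 2 ≤ r)
    (h6 : 6 ≤ Fintype.card V) {b : V} (hb : b ∈ Core G) :
    ∃ a ∈ Core G, ∃ c ∈ Core G, a ≠ c ∧ G.Adj b a ∧ G.Adj b c := by
  by_cases hno : ∀ a, G.Adj b a → a ∈ Core G
  · obtain ⟨p, q, hpq, hp, hq⟩ := hb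
    exact ⟨p, hno p hp, q, hno q hq, hpq, hp, hq⟩
  · push Not at hno
    obtain ⟨a, ha, hac⟩ := hno
    rcases h.leaf_eq hr hac with rfl | rfl
    · exact h.core_two_aux hr h6 hb hac ha
    · exact h.symm.core_two_aux hr h6 hb hac ha

theorem Ctx.core_nb [Fintype V] {x y : V} {r : ℕ} (h : Ctx G x y r) (hr : 2 ≤ r)
    (h6 : 6 ≤ Fintype.card V) :
    ∀ a ∈ Core G, ∀ b ∈ Core G, G.Adj a b → ∃ c ∈ Core G, G.Adj b c ∧ c ≠ a := by
  intro a _ b hb _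
  obtain ⟨p, hp, q, hq, hpq, h1, h2⟩ := h.core_two hr h6 hb
  by_cases hpa : p = a
  · exact ⟨q, hq, h2, fun hqa => hpq (hpa.trans hqa.symm)⟩
  · exact ⟨p, hp, h1, hpa⟩

/-- neighbour of a leaf is in the core -/
theorem leaf_nbr [Fintype V] (hc : G.Connected) (h6 : 6 ≤ Fintype.card V) {v a : V}
    (hv : v ∉ Core G) (ha : G.Adj v a) : a ∈ Core G := by
  classical
  by_contra hcon
  have : ∃ w, w ∉ ({v, a} : Finset V) := by
    by_contra hno
    push Not at hno
    have : Fintype.card V ≤ 2 := by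
      rw [← Finset.card_univ]
      exact (Finset.card_le_card (fun w _ => hno w)).trans Finset.card_le_two
    omega
  obtain ⟨w, hw⟩ := this
  simp at hw
  push Not at hw
  have h1 := leaf_dist hc hv ha hw.1.symm
  have h2 := leaf_dist hc hcon ha.symm hw.2.symm
  omega

theorem Ctx.exists_core_edge [Fintype V] {x y : V} {r : ℕ} (h : Ctx G x y r) (hr : 2 ≤ r)
    (h6 : 6 ≤ Fintype.card V) : ∃ a ∈ Core G, ∃ b ∈ Core G, G.Adj a b := by
  have : ∃ a, a ∈ Core G := by
    have : Nontrivial V := ⟨x, y, h.ne⟩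
    obtain ⟨a, ha⟩ := h.conn.preconnected.exists_adj_of_nontrivial x
    by_cases hx : x ∈ Core G
    · exact ⟨x, hx⟩
    · exact ⟨a, leaf_nbr h.conn h6 hx ha⟩
  obtain ⟨a, ha⟩ := this
  obtain ⟨b, hb, -, -, -, h1, -⟩ := h.core_two hr h6 ha
  exact ⟨a, ha, b, hb, h1⟩

/-- radius at least two, from girth at least five -/
theorem Ctx.two_le [Fintype V] {x y : V} {r g : ℕ} (h : Ctx G x y r) (hg : GirthGE G g)
    (h5 : 5 ≤ g) (h6 : 6 ≤ Fintype.card V) : 2 ≤ r := by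
  classical
  by_contra hlt
  have h4 : 4 ≤ (({x, y} : Finset V)ᶜ).card := by
    rw [Finset.card_compl, Finset.card_pair h.ne]; omega
  obtain ⟨T, hT, hTc⟩ := Finset.exists_subset_card_eq (show 3 ≤ (({x, y} : Finset V)ᶜ).card by omega)
  obtain ⟨a, b, c, hab, hac, hbc, rfl⟩ := Finset.card_eq_three.mp hTc
  have hadj : ∀ s t, s ∈ (({x, y} : Finset V)ᶜ) → s ≠ t → G.Adj s t := by
    intro s t hs hst
    simp at hs
    push Not at hs
    have h1 := h.conn.pos_dist_of_ne hst
    rcases h.le s t with h2 | h2 | h2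
    · exact dist_eq_one_iff_adj.1 (by omega)
    · exact absurd h2.1 hs.1
    · exact absurd h2.1 hs.2
  have ha := hT (show a ∈ ({a, b, c} : Finset V) by simp)
  have hb := hT (show b ∈ ({a, b, c} : Finset V) by simp)
  have hc := hT (show c ∈ ({a, b, c} : Finset V) by simp)
  have := hg (fun i => if i = 0 then a else if i = 1 then b else c) 2 le_rfl ⟨?_, ?_⟩ ?_
  · omega
  · intro i hi
    interval_cases i
    · simpa using hadj a b ha hab
    · simpa using hadj b c hb hbc
  · intro i hi j hj he
    interval_cases i <;> interval_cases j <;> simp_all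
  · simpa using hadj c a hc hac.symm

/-- covering lemma -/
theorem cover (hc : G.Connected) (K : Set V) (v₀ : V)
    (h0 : v₀ ∈ K) (hcl : ∀ v ∈ K, ∀ w ∈ Core G, G.Adj v w → w ∈ K) :
    ∀ w ∈ Core G, w ∈ K := by
  have key : ∀ (w u : V) (p : G.Walk u w), (u ∈ K ∨ (u ∉ Core G ∧ ∃ a ∈ K, G.Adj u a)) →
      (w ∈ K ∨ (w ∉ Core G ∧ ∃ a ∈ K, G.Adj w a)) := by
    intro w u p
    induction p with
    | nil => exact id
    | cons hadj q ih =>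
      intro hu
      apply ih
      rename_i a b c
      rcases hu with hu | ⟨hu, d, hd, had⟩
      · by_cases hb : b ∈ Core G
        · exact Or.inl (hcl _ hu _ hb hadj)
        · exact Or.inr ⟨hb, _, hu, hadj.symm⟩
      · rw [leaf_unique hu hadj had]
        exact Or.inl hd
  intro w hw
  obtain ⟨p⟩ := hc.preconnected v₀ w
  rcases key w v₀ p (Or.inl h0) with h | h
  · exact h
  · exact absurd hw h.1

end ASC


namespace ASC

variable {V : Type*} {G : SimpleGraph V}

theorem lips (hc : G.Connected) (P : V → ℕ → Prop) (s : V) (h0 : ∀ m, P s m → m = 0)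
    (hstep : ∀ v w m, G.Adj v w → P w m → ∃ m', P v m' ∧ m ≤ m' + 1) :
    ∀ w m, P w m → m ≤ G.dist s w := by
  intro w m hw
  obtain ⟨p, hp⟩ := hc.exists_walk_length_eq_dist w s
  rw [G.dist_comm, ← hp]
  clear hp
  induction p generalizing m with
  | nil => simp [h0 m hw]
  | cons hadj q ih =>
    obtain ⟨m', h1, h2⟩ := hstep _ _ m hadj.symm hw
    have := ih h0 m' h1
    simp
    omega

theorem lips_core (hc : G.Connected) (F : V → ℕ → Prop) (s : V) (hs : s ∈ Core G)
    (h0 : ∀ m, F s m → m = 0)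
    (hstep : ∀ v ∈ Core G, ∀ w ∈ Core G, ∀ m, G.Adj v w → F w m → ∃ m', F v m' ∧ m ≤ m' + 1) :
    ∀ w ∈ Core G, ∀ m, F w m → m ≤ G.dist s w := by
  intro w hw m hF
  refine lips hc (fun v m => ∃ c ∈ Core G, (c = v ∨ (v ∉ Core G ∧ G.Adj v c)) ∧ F c m) s ?_ ?_ w m
    ⟨w, hw, Or.inl rfl, hF⟩
  · rintro m ⟨c, hc, rfl | h, hF⟩
    · exact h0 m hF
    · exact absurd hs h.1
  · rintro v w m hadj ⟨c, hc, rfl | h, hF⟩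
    · by_cases hv : v ∈ Core G
      · obtain ⟨m', h1, h2⟩ := hstep v hv c hc m hadj hF
        exact ⟨m', ⟨v, hv, Or.inl rfl, h1⟩, h2⟩
      · exact ⟨m, ⟨c, hc, Or.inr ⟨hv, hadj⟩, hF⟩, by omega⟩
    · have := leaf_unique h.1 h.2 hadj.symm
      subst this
      exact ⟨m, ⟨c, hc, Or.inl rfl, hF⟩, by omega⟩

/-- A cycle in the core given as a periodic sequence. -/
structure Cyc (G : SimpleGraph V) (z : ℕ → V) (L : ℕ) : Prop where
  three : 3 ≤ L
  core : ∀ i, z i ∈ Core G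
  adj : ∀ i, G.Adj (z i) (z (i + 1))
  per : ∀ i, z (i + L) = z i
  inj : ∀ i < L, ∀ j < L, z i = z j → i = j

theorem Cyc.mod {z : ℕ → V} {L : ℕ} (h : Cyc G z L) (i : ℕ) : z i = z (i % L) := by
  have key : ∀ k i, z (i + L * k) = z i := by
    intro k
    induction k with
    | zero => simp
    | succ k ih => intro i; rw [Nat.mul_succ, ← add_assoc, h.per, ih]
  conv_lhs => rw [← Nat.mod_add_div i L]
  rw [key]

theorem Cyc.shift {z : ℕ → V} {L : ℕ} (h : Cyc G z L) (a : ℕ) : Cyc G (fun i => z (a + i)) L := by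
  have hL := h.three
  refine ⟨h.three, fun i => h.core _, fun i => h.adj _, fun i => ?_, ?_⟩
  · rw [← add_assoc, h.per]
  · intro i hi j hj he
    rw [h.mod (a + i), h.mod (a + j)] at he
    have := h.inj _ (Nat.mod_lt _ (by omega)) _ (Nat.mod_lt _ (by omega)) he
    have h2 : i ≡ j [MOD L] := Nat.ModEq.add_left_cancel' a this
    rwa [Nat.ModEq, Nat.mod_eq_of_lt hi, Nat.mod_eq_of_lt hj] at h2

/-- the core is exactly the cycle -/
structure Uni (G : SimpleGraph V) (z : ℕ → V) (L : ℕ) : Prop extends Cyc G z L where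
  only : ∀ i, ∀ w ∈ Core G, G.Adj (z i) w → w = z (i + 1) ∨ w = z (i + L - 1)

theorem Uni.shift {z : ℕ → V} {L : ℕ} (h : Uni G z L) (a : ℕ) : Uni G (fun i => z (a + i)) L := by
  refine ⟨h.toCyc.shift a, fun i w hw hadj => ?_⟩
  have := h.only (a + i) w hw hadj
  have h3 := h.three
  rwa [show a + i + L - 1 = a + (i + L - 1) by omega] at this

theorem Uni.cover {z : ℕ → V} {L : ℕ} (h : Uni G z L) (hc : G.Connected) :
    ∀ w ∈ Core G, ∃ i < L, w = z i := by
  have hL := h.three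
  have := ASC.cover hc {w | ∃ i < L, w = z i} (z 0) ⟨0, by omega, rfl⟩ ?_
  · exact this
  · rintro v ⟨i, hi, rfl⟩ w hw hadj
    rcases h.only i w hw hadj with h1 | h1
    · exact ⟨_, Nat.mod_lt (i + 1) (by omega), by rw [h1, h.mod]⟩
    · exact ⟨_, Nat.mod_lt (i + L - 1) (by omega), by rw [h1, h.mod]⟩

theorem Uni.dist0_ge {z : ℕ → V} {L : ℕ} (h : Uni G z L) (hc : G.Connected) (m : ℕ) (hm : m ≤ L) :
    min m (L - m) ≤ G.dist (z 0) (z m) := by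
  have hL := h.three
  have hzL : z L = z 0 := by simpa using h.per 0
  refine lips_core hc (fun w k => ∃ j ≤ L, w = z j ∧ k = min j (L - j)) (z 0) (h.core 0) ?_ ?_
    (z m) (h.core m) _ ⟨m, hm, rfl, rfl⟩
  · rintro k ⟨j, hj, he, rfl⟩
    by_cases hjL : j = L
    · omega
    · have := h.inj 0 (by omega) j (by omega) he
      omega
  · rintro v hv w hw k hadj ⟨j, hj, rfl, rfl⟩
    rcases h.only j v hv hadj.symm with h1 | h1
    · by_cases hjL : j = L
      · subst hjL
        refine ⟨_, ⟨1, by omega, ?_, rfl⟩, by omega⟩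
        rw [h1, add_comm, h.per]
      · exact ⟨_, ⟨j + 1, by omega, h1, rfl⟩, by omega⟩
    · by_cases hj0 : j = 0
      · subst hj0
        exact ⟨_, ⟨L - 1, by omega, by rw [h1]; congr 1; omega, rfl⟩, by omega⟩
      · refine ⟨_, ⟨j - 1, by omega, ?_, rfl⟩, by omega⟩
        rw [h1, show j + L - 1 = j - 1 + L by omega, h.per]

theorem Uni.dist0 {z : ℕ → V} {L : ℕ} (h : Uni G z L) (hc : G.Connected) (m : ℕ) (hm : m ≤ L) :
    G.dist (z 0) (z m) = min m (L - m) := by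
  have h1 := h.dist0_ge hc m hm
  have h2 := dist_seq_le z m (fun i _ => h.adj i) 0 m (by omega) le_rfl
  have h3 := dist_seq_le z L (fun i _ => h.adj i) m L (by omega) le_rfl
  have hzL : z L = z 0 := by simpa using h.per 0
  rw [hzL, G.dist_comm] at h3
  omega

theorem Uni.dist {z : ℕ → V} {L : ℕ} (h : Uni G z L) (hc : G.Connected) (a m : ℕ) (hm : m ≤ L) :
    G.dist (z a) (z (a + m)) = min m (L - m) := by
  simpa using (h.shift a).dist0 hc m hm

theorem Uni.card_image [DecidableEq V] {z : ℕ → V} {L : ℕ} (h : Uni G z L) :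
    ((Finset.range L).image z).card = L := by
  rw [Finset.card_image_of_injOn, Finset.card_range]
  intro i hi j hj he
  simp at hi hj
  exact h.inj i hi j hj he

theorem Uni.leaf_base {z : ℕ → V} {L : ℕ} (h : Uni G z L) (hc : G.Connected) {v a : V}
    (ha : a ∈ Core G) (hv : v ∉ Core G) (hva : G.Adj v a) :
    ∃ z', Uni G z' L ∧ G.Adj v (z' 0) := by
  obtain ⟨i, -, rfl⟩ := h.cover hc a ha
  exact ⟨_, h.shift i, by simpa using hva⟩

theorem uni_false_one [Fintype V] {x y : V} {r L : ℕ} {z : ℕ → V} (h : Ctx G x y r) (hr : 2 ≤ r)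
    (h6 : 6 ≤ Fintype.card V) (hev : Even (Fintype.card V)) (hU : Uni G z L) (hx : x ∉ Core G)
    (hy : y ∈ Core G) : False := by
  classical
  have : Nontrivial V := ⟨x, y, h.ne⟩
  obtain ⟨a, ha⟩ := h.conn.preconnected.exists_adj_of_nontrivial x
  have hac := leaf_nbr h.conn h6 hx ha
  obtain ⟨z, hU, hz⟩ := hU.leaf_base h.conn hac hx ha
  have hxz : ∀ i, x ≠ z i := fun i he => hx (he ▸ hU.core i)
  have hcard : Fintype.card V = L + 1 := by
    have : (Finset.univ : Finset V) = insert x ((Finset.range L).image z) := by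
      ext w
      simp only [Finset.mem_univ, Finset.mem_insert, Finset.mem_image, Finset.mem_range, true_iff]
      by_cases hw : w ∈ Core G
      · obtain ⟨i, hi, he⟩ := hU.cover h.conn w hw
        exact Or.inr ⟨i, hi, he.symm⟩
      · rcases h.leaf_eq hr hw with rfl | rfl
        · exact Or.inl rfl
        · exact absurd hy hw
    rw [← Finset.card_univ, this, Finset.card_insert_of_notMem, hU.card_image]
    simp only [Finset.mem_image, not_exists, not_and]
    exact fun i _ he => hxz i he.symm
  have hd : ∀ m ≤ L, G.dist x (z m) = min m (L - m) + 1 := fun m hm => by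
    rw [leaf_dist h.conn hx hz (hxz m), hU.dist0 h.conn m hm]
  obtain ⟨m, hm, rfl⟩ := hU.cover h.conn y hy
  have e1 := hd m hm.le
  rw [h.dxy] at e1
  rw [hcard] at hev
  obtain ⟨k, hk⟩ := hev
  have key : ∀ j < L, min j (L - j) = k - 1 → j = m := by
    intro j hj hjk
    have e2 := hd j hj.le
    rcases h.le x (z j) with h1 | h1 | h1
    · omega
    · exact hU.inj j hj m hm h1.2
    · exact absurd h1.1 (hxz m)
  have hL := hU.three
  have := key (k - 1) (by omega) (by omega)
  have := key k (by omega) (by omega)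
  omega

theorem uni_false [Fintype V] {x y : V} {r L : ℕ} {z : ℕ → V} (h : Ctx G x y r) (hr : 2 ≤ r)
    (h6 : 6 ≤ Fintype.card V) (hev : Even (Fintype.card V)) (hU : Uni G z L) : False := by
  classical
  have hL := hU.three
  by_cases hx : x ∈ Core G
  · by_cases hy : y ∈ Core G
    · obtain ⟨i, hi, hxi⟩ := hU.cover h.conn x hx
      have hU' := hU.shift i
      obtain ⟨m, hm, hym⟩ := hU'.cover h.conn y hy
      have e1 := hU'.dist0 h.conn m hm.le
      have e2 := hU'.dist h.conn 1 m hm.le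
      simp only [add_zero] at e1
      rw [← hxi, ← hym, h.dxy] at e1
      rcases h.le (z (i + 1)) (z (i + (1 + m))) with h1 | h1 | h1
      · omega
      · have := hU'.inj 1 (by omega) 0 (by omega) (by simpa using h1.1.trans hxi)
        omega
      · have := hU'.inj 1 (by omega) m (by omega) (by simpa using h1.1.trans hym)
        omega
    · exact uni_false_one h.symm hr h6 hev hU hy hx
  · by_cases hy : y ∈ Core G
    · exact uni_false_one h hr h6 hev hU hx hy
    · have : Nontrivial V := ⟨x, y, h.ne⟩
      obtain ⟨a, ha⟩ := h.conn.preconnected.exists_adj_of_nontrivial x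
      have hac := leaf_nbr h.conn h6 hx ha
      obtain ⟨b, hb⟩ := h.conn.preconnected.exists_adj_of_nontrivial y
      have hbc := leaf_nbr h.conn h6 hy hb
      obtain ⟨z, hU, hz⟩ := hU.leaf_base h.conn hac hx ha
      obtain ⟨m, hm, rfl⟩ := hU.cover h.conn b hbc
      have hxz : ∀ i, x ≠ z i := fun i he => hx (he ▸ hU.core i)
      have hyz : ∀ i, y ≠ z i := fun i he => hy (he ▸ hU.core i)
      have hcard : Fintype.card V = L + 2 := by
        have : (Finset.univ : Finset V) = insert x (insert y ((Finset.range L).image z)) := by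
          ext w
          simp only [Finset.mem_univ, Finset.mem_insert, Finset.mem_image, Finset.mem_range,
            true_iff]
          by_cases hw : w ∈ Core G
          · obtain ⟨i, hi, he⟩ := hU.cover h.conn w hw
            exact Or.inr (Or.inr ⟨i, hi, he.symm⟩)
          · rcases h.leaf_eq hr hw with rfl | rfl <;> simp
        rw [← Finset.card_univ, this, Finset.card_insert_of_notMem,
          Finset.card_insert_of_notMem, hU.card_image]
        · simp only [Finset.mem_image, not_exists, not_and]
          exact fun i _ he => hyz i he.symm
        · simp only [Finset.mem_insert, Finset.mem_image, not_exists, not_and, not_or]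
          exact ⟨h.ne, fun i _ he => hxz i he.symm⟩
      rw [hcard] at hev
      obtain ⟨k, hk⟩ := hev
      have hdx : ∀ j ≤ L, G.dist x (z j) = min j (L - j) + 1 := fun j hj => by
        rw [leaf_dist h.conn hx hz (hxz j), hU.dist0 h.conn j hj]
      have e1 : G.dist y x = G.dist (z m) x + 1 := leaf_dist h.conn hy hb h.ne.symm
      rw [G.dist_comm, h.dxy, G.dist_comm, hdx m hm.le] at e1
      have e2 := hdx (k - 1) (by omega)
      have e3 : G.dist x (z (k - 1)) ≤ r := by
        rcases h.le x (z (k - 1)) with h1 | h1 | h1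
        · exact h1
        · exact absurd h1.2.symm (hyz _)
        · exact absurd h1.2.symm (hxz _)
      have hmk : m = k - 1 := by omega
      obtain ⟨t, ht⟩ := h.ecc (z 1) (hxz 1).symm (hyz 1).symm
      by_cases htc : t ∈ Core G
      · obtain ⟨j, hj, hjt⟩ := (hU.shift 1).cover h.conn t htc
        have := hU.dist h.conn 1 j hj.le
        rw [← hjt, ht] at this
        omega
      · rcases h.leaf_eq hr htc with rfl | rfl
        · rw [G.dist_comm, hdx 1 (by omega)] at ht
          omega
        · rw [G.dist_comm, leaf_dist h.conn hy hb (hyz 1), G.dist_comm] at ht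
          have := hU.dist h.conn 1 (m - 1) (by omega)
          rw [show 1 + (m - 1) = m by omega] at this
          omega

end ASC


namespace ASC

variable {V : Type*} {G : SimpleGraph V}

/-- Three internally disjoint paths in the core with common ends. -/
structure Theta (G : SimpleGraph V) (P : Fin 3 → ℕ → V) (L : Fin 3 → ℕ) (u v : V) : Prop where
  start : ∀ β, P β 0 = u
  last : ∀ β, P β (L β) = v
  pos : ∀ β, 1 ≤ L β
  arc : ∀ β, Arc G (P β) (L β)
  core : ∀ β, ∀ i ≤ L β, P β i ∈ Core G
  simple : ∀ β γ, β ≠ γ → 3 ≤ L β + L γ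
  inj : ∀ β γ, β ≠ γ → ∀ i ≤ L β, ∀ j ≤ L γ, P β i = P γ j → (i = 0 ∧ j = 0) ∨ (i = L β ∧ j = L γ)

theorem Theta.perm {P : Fin 3 → ℕ → V} {L : Fin 3 → ℕ} {u v : V} (h : Theta G P L u v)
    (σ : Equiv.Perm (Fin 3)) : Theta G (fun β => P (σ β)) (fun β => L (σ β)) u v where
  start β := h.start _
  last β := h.last _
  pos β := h.pos _
  arc β := h.arc _
  core β := h.core _
  simple β γ hne := h.simple _ _ (fun he => hne (σ.injective he))
  inj β γ hne := h.inj _ _ (fun he => hne (σ.injective he))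

theorem Theta.rev {P : Fin 3 → ℕ → V} {L : Fin 3 → ℕ} {u v : V} (h : Theta G P L u v) :
    Theta G (fun β i => P β (L β - i)) L v u where
  start β := by simpa using h.last β
  last β := by simpa using h.start β
  pos β := h.pos _
  arc β := (h.arc _).rev
  core β i hi := h.core _ _ (by omega)
  simple := h.simple
  inj β γ hne i hi j hj he := by
    have := h.inj β γ hne _ (by omega) _ (by omega) he
    omega

theorem Theta.pair {P : Fin 3 → ℕ → V} {L : Fin 3 → ℕ} {u v : V} (h : Theta G P L u v) {g : ℕ}
    (hg : GirthGE G g) (β γ : Fin 3) (hne : β ≠ γ) : g ≤ L β + L γ :=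
  close_arcs hg (P β) (P γ) (L β) (L γ) (h.arc β) (h.arc γ) (by rw [h.start, h.start])
    (by rw [h.last, h.last]) (h.simple _ _ hne) (h.pos _) (h.inj β γ hne)

/-- edge of the theta -/
def TE (P : Fin 3 → ℕ → V) (L : Fin 3 → ℕ) (s w : V) : Prop :=
  ∃ γ t, t < L γ ∧ ((s = P γ t ∧ w = P γ (t + 1)) ∨ (w = P γ t ∧ s = P γ (t + 1)))

/-- vertex set of a theta -/
def TV [DecidableEq V] (P : Fin 3 → ℕ → V) (L : Fin 3 → ℕ) : Finset V :=
  (Finset.range (L 0 + 1)).image (P 0) ∪ ((Finset.Ioo 0 (L 1)).image (P 1) ∪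
    (Finset.Ioo 0 (L 2)).image (P 2))

theorem Theta.mem_TV [DecidableEq V] {P : Fin 3 → ℕ → V} {L : Fin 3 → ℕ} {u v : V}
    (h : Theta G P L u v) (w : V) : w ∈ TV P L ↔ ∃ β, ∃ i ≤ L β, w = P β i := by
  simp only [TV, Finset.mem_union, Finset.mem_image, Finset.mem_range, Finset.mem_Ioo]
  constructor
  · rintro (⟨i, hi, rfl⟩ | ⟨i, hi, rfl⟩ | ⟨i, hi, rfl⟩)
    · exact ⟨0, i, by omega, rfl⟩
    · exact ⟨1, i, by omega, rfl⟩
    · exact ⟨2, i, by omega, rfl⟩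
  · rintro ⟨β, i, hi, rfl⟩
    by_cases h0 : i = 0
    · exact Or.inl ⟨0, by omega, by rw [h0, h.start, h.start]⟩
    by_cases h1 : i = L β
    · exact Or.inl ⟨L 0, by omega, by rw [h1, h.last, h.last]⟩
    have : i < L β := by omega
    have : 0 < i := by omega
    match β with
    | 0 => exact Or.inl ⟨i, by omega, rfl⟩
    | 1 => exact Or.inr (Or.inl ⟨i, by omega, rfl⟩)
    | 2 => exact Or.inr (Or.inr ⟨i, by omega, rfl⟩)

theorem Theta.card_TV [DecidableEq V] {P : Fin 3 → ℕ → V} {L : Fin 3 → ℕ} {u v : V}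
    (h : Theta G P L u v) : (TV P L).card + 1 = L 0 + L 1 + L 2 := by
  rw [TV, Finset.card_union_of_disjoint, Finset.card_union_of_disjoint,
    Finset.card_image_of_injOn, Finset.card_image_of_injOn, Finset.card_image_of_injOn]
  · simp
    have := h.pos 0
    have := h.pos 1
    have := h.pos 2
    omega
  · intro i hi j hj he
    simp at hi hj
    exact (h.arc 2).2 i (by omega) j (by omega) he
  · intro i hi j hj he
    simp at hi hj
    exact (h.arc 1).2 i (by omega) j (by omega) he
  · intro i hi j hj he
    simp at hi hj
    exact (h.arc 0).2 i (by omega) j (by omega) he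
  · rw [Finset.disjoint_left]
    simp only [Finset.mem_union, Finset.mem_image, Finset.mem_range, Finset.mem_Ioo]
    rintro w ⟨i, hi, rfl⟩ ⟨j, hj, he⟩
    have := h.inj 2 1 (by decide) j (by omega) i (by omega) he
    omega
  · rw [Finset.disjoint_left]
    simp only [Finset.mem_union, Finset.mem_image, Finset.mem_range, Finset.mem_Ioo]
    rintro w ⟨i, hi, rfl⟩ (⟨j, hj, he⟩ | ⟨j, hj, he⟩)
    · have := h.inj 1 0 (by decide) j (by omega) i (by omega) he
      omega
    · have := h.inj 2 0 (by decide) j (by omega) i (by omega) he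
      omega

/-- An ear of a theta. -/
structure Ear (G : SimpleGraph V) (P : Fin 3 → ℕ → V) (L : Fin 3 → ℕ) (q : ℕ → V) (l : ℕ) :
    Prop where
  arc : Arc G q l
  pos : 1 ≤ l
  off : ∀ t, 0 < t → t < l → ∀ γ, ∀ s ≤ L γ, q t ≠ P γ s
  new : ¬ (l = 1 ∧ TE P L (q 0) (q l))

theorem Ear.rev {P : Fin 3 → ℕ → V} {L : Fin 3 → ℕ} {q : ℕ → V} {l : ℕ}
    (h : Ear G P L q l) : Ear G P L (fun i => q (l - i)) l where
  arc := h.arc.rev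
  pos := h.pos
  off t h1 h2 := h.off _ (by omega) (by omega)
  new := by
    rintro ⟨h1, γ, t, h2, h3⟩
    simp only [Nat.sub_zero, Nat.sub_self] at h3
    exact h.new ⟨h1, γ, t, h2, by tauto⟩

theorem Ear.trev {P : Fin 3 → ℕ → V} {L : Fin 3 → ℕ} {q : ℕ → V} {l : ℕ}
    (h : Ear G P L q l) : Ear G (fun β i => P β (L β - i)) L q l where
  arc := h.arc
  pos := h.pos
  off t h1 h2 γ s hs := h.off _ h1 h2 γ _ (by omega)
  new := by
    rintro ⟨h1, γ, t, h2, h3⟩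
    refine h.new ⟨h1, γ, L γ - (t + 1), by omega, ?_⟩
    rw [show L γ - (t + 1) + 1 = L γ - t by omega]
    tauto

/-- cycle through an ear with both ends on the same branch -/
theorem Theta.ear_same1 {P : Fin 3 → ℕ → V} {L : Fin 3 → ℕ} {u v : V} (h : Theta G P L u v) {g : ℕ}
    (hg : GirthGE G g) {q : ℕ → V} {l : ℕ} (hq : Ear G P L q l) (β : Fin 3) (i j : ℕ) (hij : i < j)
    (hj : j ≤ L β) (h0 : q 0 = P β i) (h1 : q l = P β j) : g ≤ l + (j - i) := by
  have hp := hq.pos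
  refine close_arcs hg q (fun t => P β (i + t)) l (j - i) hq.arc ((h.arc β).sub i _ (by omega))
    (by simpa using h0) (by rw [h1, Nat.add_sub_cancel' hij.le]) ?_ (by omega) ?_
  · by_contra hlt
    have e1 : l = 1 := by omega
    have e2 : j = i + 1 := by omega
    exact hq.new ⟨e1, β, i, by omega, Or.inl ⟨h0, by rw [h1, e2]⟩⟩
  · intro a ha b hb he
    by_cases ha0 : a = 0
    · rw [ha0, h0] at he
      have := (h.arc β).2 _ (by omega) _ (by omega) he
      omega
    · by_cases hal : a = l
      · rw [hal, h1] at he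
        have := (h.arc β).2 _ (by omega) _ (by omega) he
        omega
      · exact absurd he (hq.off a (by omega) (by omega) β _ (by omega))

/-- rerouting a branch through an ear -/
theorem Theta.ear_same2 {P : Fin 3 → ℕ → V} {L : Fin 3 → ℕ} {u v : V} (h : Theta G P L u v) {g : ℕ}
    (hg : GirthGE G g) {q : ℕ → V} {l : ℕ} (hq : Ear G P L q l) (β : Fin 3) (i j : ℕ) (hij : i < j)
    (hj : j ≤ L β) (h0 : q 0 = P β i) (h1 : q l = P β j) (γ : Fin 3) (hne : β ≠ γ) :
    g ≤ i + l + (L β - j) + L γ := by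
  have hp := hq.pos
  have hpg := h.pos γ
  have c1 := ((h.arc β).sub 0 i (by omega)).cat hq.arc (by simpa using h0.symm) (by
    intro a ha b hb he
    simp only [Nat.zero_add] at he
    by_cases hb0 : b = 0
    · rw [hb0, h0] at he
      have := (h.arc β).2 _ (by omega) _ (by omega) he
      omega
    · by_cases hbl : b = l
      · rw [hbl, h1] at he
        have := (h.arc β).2 _ (by omega) _ (by omega) he
        omega
      · exact absurd he.symm (hq.off b (by omega) (by omega) β _ (by omega)))
  have c2 := c1.cat ((h.arc β).sub j (L β - j) (by omega)) (by
    simp only [Nat.zero_add, add_zero]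
    rw [if_neg (by omega), Nat.add_sub_cancel_left, h1]) (by
    intro a ha b hb he
    simp only [Nat.zero_add] at he
    split_ifs at he with hai
    · have := (h.arc β).2 _ (by omega) _ (by omega) he
      omega
    · by_cases hal : a - i = l
      · rw [hal, h1] at he
        have := (h.arc β).2 _ (by omega) _ (by omega) he
        omega
      · exact absurd he (hq.off (a - i) (by omega) (by omega) β _ (by omega)))
  refine close_arcs hg _ (P γ) _ _ c2 (h.arc γ) ?_ ?_ ?_ hpg ?_
  · simp [h.start]
  · simp only [Nat.zero_add]
    by_cases hjl : j = L β
    · rw [if_pos (by omega), if_neg (by omega), show i + l + (L β - j) - i = l by omega, h1, hjl,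
        h.last, h.last]
    · rw [if_neg (by omega), show j + (i + l + (L β - j) - (i + l)) = L β by omega,
        h.last, h.last]
  · by_contra hlt
    have e1 : l = 1 := by omega
    have e2 : i = 0 := by omega
    have e3 : j = L β := by omega
    have e4 : L γ = 1 := by omega
    refine hq.new ⟨e1, γ, 0, by omega, Or.inl ⟨?_, ?_⟩⟩
    · rw [h0, e2, h.start, h.start]
    · rw [h1, e3, h.last, Nat.zero_add, ← e4, h.last]
  · intro a ha b hb he
    simp only [Nat.zero_add] at he
    split_ifs at he with ha1 ha2
    · have := h.inj β γ hne _ (by omega) _ hb he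
      omega
    · by_cases hal : a - i = l
      · rw [hal, h1] at he
        have := h.inj β γ hne _ (by omega) _ hb he
        omega
      · exact absurd he (hq.off (a - i) (by omega) (by omega) γ _ (by omega))
    · have := h.inj β γ hne _ (by omega) _ hb he
      omega

/-- ear between different branches -/
theorem Theta.ear_diff {P : Fin 3 → ℕ → V} {L : Fin 3 → ℕ} {u v : V} (h : Theta G P L u v) {g : ℕ}
    (hg : GirthGE G g) {q : ℕ → V} {l : ℕ} (hq : Ear G P L q l) (β γ : Fin 3) (hne : β ≠ γ)
    (i j : ℕ) (hi0 : 0 < i) (hi : i < L β) (hj0 : 0 < j) (hj : j < L γ) (h0 : q 0 = P β i)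
    (h1 : q l = P γ j) : g ≤ i + l + j := by
  have hp := hq.pos
  have c1 := ((h.arc β).sub 0 i (by omega)).cat hq.arc (by simpa using h0.symm) (by
    intro a ha b hb he
    simp only [Nat.zero_add] at he
    by_cases hb0 : b = 0
    · rw [hb0, h0] at he
      have := (h.arc β).2 _ (by omega) _ (by omega) he
      omega
    · by_cases hbl : b = l
      · rw [hbl, h1] at he
        have := h.inj β γ hne _ (by omega) _ (by omega) he
        omega
      · exact absurd he.symm (hq.off b (by omega) (by omega) β _ (by omega)))
  refine close_arcs hg _ (fun t => P γ (0 + t)) _ j c1 ((h.arc γ).sub 0 j (by omega)) ?_ ?_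
    (by omega) (by omega) ?_
  · simp [h.start]
  · simp only [Nat.zero_add]
    rw [if_neg (by omega), Nat.add_sub_cancel_left, h1]
  · intro a ha b hb he
    simp only [Nat.zero_add] at he
    split_ifs at he with ha1
    · have := h.inj β γ hne _ (by omega) _ (by omega) he
      omega
    · by_cases hal : a - i = l
      · rw [hal, h1] at he
        have := (h.arc γ).2 _ (by omega) _ (by omega) he
        omega
      · exact absurd he (hq.off (a - i) (by omega) (by omega) γ _ (by omega))

/-- vertex count -/
theorem Theta.ear_card [Fintype V] [DecidableEq V] {P : Fin 3 → ℕ → V} {L : Fin 3 → ℕ} {u v : V}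
    (h : Theta G P L u v) {q : ℕ → V} {l : ℕ} (hq : Ear G P L q l) :
    (TV P L ∪ (Finset.Ioo 0 l).image q).card + 2 = L 0 + L 1 + L 2 + l := by
  have := h.card_TV
  have hp := hq.pos
  have hp0 := h.pos 0
  rw [Finset.card_union_of_disjoint, Finset.card_image_of_injOn]
  · simp
    omega
  · intro i hi j hj he
    simp at hi hj
    exact hq.arc.2 i (by omega) j (by omega) he
  · rw [Finset.disjoint_left]
    intro w hw hw'
    rw [h.mem_TV] at hw
    obtain ⟨β, i, hi, rfl⟩ := hw
    simp only [Finset.mem_image, Finset.mem_Ioo] at hw'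
    obtain ⟨t, ht, he⟩ := hw'
    exact hq.off t ht.1 ht.2 β i hi he

end ASC


namespace ASC

variable {V : Type*} {G : SimpleGraph V}

theorem geodesic (hc : G.Connected) (t : V) : ∀ (d : ℕ) (s : V), G.dist s t = d →
    ∃ f : ℕ → V, Arc G f d ∧ f 0 = s ∧ f d = t ∧ (∀ i ≤ d, G.dist (f i) t = d - i) := by
  intro d
  induction d with
  | zero =>
    intro s hs
    refine ⟨fun _ => s, ⟨fun i hi => by omega, fun i hi j hj _ => by omega⟩, rfl, ?_, ?_⟩
    · exact (hc.dist_eq_zero_iff).1 hs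
    · intro i hi
      simpa using hs
  | succ d ih =>
    intro s hs
    have hne : s ≠ t := by
      rintro rfl
      simp at hs
    obtain ⟨a, ha, had⟩ := exists_adj_dist hc hne
    obtain ⟨f, h1, h2, h3, h4⟩ := ih a (by omega)
    have h5 : ∀ i ≤ d + 1, G.dist ((fun i => if i = 0 then s else f (i - 1)) i) t = d + 1 - i := by
      intro i hi
      by_cases h0 : i = 0
      · simp [h0, hs]
      · simp only [h0, if_false]
        rw [h4 _ (by omega)]
        omega
    refine ⟨fun i => if i = 0 then s else f (i - 1), ⟨?_, ?_⟩, by simp, by simpa using h3, h5⟩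
    · intro i hi
      by_cases h0 : i = 0
      · simp [h0, h2, ha]
      · simp only [h0, if_false, show i + 1 ≠ 0 by omega]
        have := h1.1 (i - 1) (by omega)
        rwa [show i - 1 + 1 = i + 1 - 1 by omega] at this
    · intro i hi j hj he
      have e1 := h5 i hi
      have e2 := h5 j hj
      rw [he] at e1
      omega

/-- Short arcs are geodesics. -/
theorem arc_geo (hc : G.Connected) {k : ℕ} (hg : GirthGE G (4 * k + 1)) : ∀ (m : ℕ) (f : ℕ → V),
    Arc G f m → m ≤ 2 * k → G.dist (f 0) (f m) = m := by
  intro m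
  induction m using Nat.strong_induction_on with
  | _ m ih =>
  intro f hf hm
  have hle := dist_seq_le f m hf.1 0 m (by omega) le_rfl
  by_contra hne
  obtain ⟨q, h1, h2, h3, h4⟩ := geodesic hc (f m) _ (f 0) rfl
  generalize hd : G.dist (f 0) (f m) = d at *
  have hpos : 0 < d := by
    by_contra h0
    have : G.dist (f 0) (f m) = 0 := by omega
    have := hf.2 _ (by omega) _ (by omega) ((hc.dist_eq_zero_iff).1 this)
    omega
  have hsub : ∀ a b, a ≤ b → b ≤ m → b - a < m → G.dist (f a) (f b) = b - a := by
    intro a b hab hb hlt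
    have := ih (b - a) hlt (fun t => f (a + t)) (hf.sub a _ (by omega)) (by omega)
    simpa [Nat.add_sub_cancel' hab] using this
  have := close_arcs hg f q m d hf h1 h2.symm h3.symm (by omega) (by omega) (by
    intro i hi j hj he
    have e1 := h4 j hj
    rw [← he] at e1
    by_cases hi0 : i = 0
    · subst hi0
      omega
    · rw [hsub i m hi le_rfl (by omega)] at e1
      by_cases him : i = m
      · omega
      · have e2 := hsub 0 i (by omega) hi (by omega)
        have e3 := dist_seq_le q d h1.1 0 j (by omega) hj
        rw [h2, ← he] at e3
        omega)
  omega

theorem Cyc.arc {z : ℕ → V} {L : ℕ} (h : Cyc G z L) (a m : ℕ) (hm : m < L) :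
    Arc G (fun i => z (a + i)) m :=
  ⟨fun i _ => h.adj _, fun i hi j hj he => (h.shift a).inj i (by omega) j (by omega) he⟩

theorem Cyc.chord {z : ℕ → V} {L g : ℕ} (h : Cyc G z L) (hg : GirthGE G g) (a m : ℕ) (hm : m < L)
    (h2 : 2 ≤ m) (hadj : G.Adj (z a) (z (a + m))) : g ≤ m + 1 :=
  hg _ m h2 (h.arc a m hm) (by simpa using hadj.symm)

theorem Cyc.off2 {z : ℕ → V} {L g : ℕ} (h : Cyc G z L) (hg : GirthGE G g) (a m : ℕ) (hm : m < L)
    (h1 : 1 ≤ m) (w : V) (hw : ∀ i, w ≠ z i) (h2 : G.Adj (z a) w) (h3 : G.Adj w (z (a + m))) :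
    g ≤ m + 2 := by
  refine hg (fun i => if i = 0 then w else z (a + (i - 1))) (m + 1) (by omega) ⟨?_, ?_⟩ ?_
  · intro i hi
    by_cases h0 : i = 0
    · simpa [h0] using h2.symm
    · simp only [h0, if_false, show i + 1 ≠ 0 by omega]
      have := (h.arc a m hm).1 (i - 1) (by omega)
      rwa [show i - 1 + 1 = i + 1 - 1 by omega] at this
  · intro i hi j hj he
    by_cases h0 : i = 0 <;> by_cases h0' : j = 0 <;> simp only [h0, h0', if_true, if_false] at he
    · omega
    · exact absurd he (hw _)
    · exact absurd he.symm (hw _)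
    · have := (h.arc a m hm).2 _ (by omega) _ (by omega) he
      omega
  · simpa using h3.symm

theorem Cyc.off_nbr {z : ℕ → V} {k : ℕ} (h : Cyc G z (4 * k + 2)) (hc : G.Connected) (hk : 1 ≤ k)
    (hg : GirthGE G (4 * k + 1)) (hd : G.dist (z 0) (z (2 * k + 1)) ≤ 2 * k) :
    ∃ w, G.Adj (z 0) w ∧ (∀ i, w ≠ z i) ∧ G.dist w (z (2 * k + 1)) ≤ 2 * k - 1 := by
  have hne : z 0 ≠ z (2 * k + 1) := fun he => by
    have := h.inj 0 (by omega) _ (by omega) he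
    omega
  obtain ⟨a, ha, had⟩ := exists_adj_dist hc hne
  refine ⟨a, ha, ?_, by omega⟩
  have key : ∀ i < 4 * k + 2, a ≠ z i := by
    rintro i hi rfl
    have hi0 : i ≠ 0 := by
      rintro rfl
      exact ha.ne rfl
    by_cases hi1 : i = 1
    · have := arc_geo hc hg (2 * k) _ (h.arc 1 (2 * k) (by omega)) le_rfl
      simp only [add_zero] at this
      rw [hi1, show 2 * k + 1 = 1 + 2 * k by omega] at had
      rw [show 2 * k + 1 = 1 + 2 * k by omega] at hd
      omega
    · by_cases hi2 : i = 4 * k + 1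
      · have := arc_geo hc hg (2 * k) _ (h.arc (2 * k + 1) (2 * k) (by omega)) le_rfl
        simp only [add_zero] at this
        rw [show 2 * k + 1 + 2 * k = i by omega, G.dist_comm] at this
        omega
      · have e1 := h.chord hg 0 i hi (by omega) (by simpa using ha)
        have e2 := h.chord hg i (4 * k + 2 - i) (by omega) (by omega) (by
          rw [show i + (4 * k + 2 - i) = 0 + (4 * k + 2) by omega, h.per]
          exact ha.symm)
        omega
  intro i
  rw [h.mod i]
  exact key _ (Nat.mod_lt _ (by omega))

/-- closing two arcs to a periodic cycle -/
theorem cyc_of_arcs (f f' : ℕ → V) (n n' : ℕ) (hf : Arc G f n)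
    (hf' : Arc G f' n') (h0 : f 0 = f' 0) (h1 : f n = f' n') (hn : 3 ≤ n + n') (hp : 1 ≤ n')
    (hd : ∀ i ≤ n, ∀ j ≤ n', f i = f' j → (i = 0 ∧ j = 0) ∨ (i = n ∧ j = n')) :
    ∃ z, Cyc G z (n + n') ∧ ∀ i ≤ n, z i = f i := by
  have hn0 : 0 < n := by
    rcases Nat.eq_zero_or_pos n with h | h
    · subst h
      have := hf'.2 0 (by omega) n' le_rfl (h0 ▸ h1)
      omega
    · exact h
  have hlt : ∀ i, i % (n + n') < n + n' := fun i => Nat.mod_lt _ (by omega)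
  let z : ℕ → V := fun i => if i % (n + n') ≤ n then f (i % (n + n')) else f' (n + n' - i % (n + n'))
  have hadj : ∀ i, G.Adj (z i) (z (i + 1)) := by
    intro i
    have hi := hlt i
    by_cases hl : i % (n + n') = n + n' - 1
    · have e : (i + 1) % (n + n') = 0 := by
        rw [Nat.add_mod, hl, Nat.mod_eq_of_lt (show 1 < n + n' by omega),
          show n + n' - 1 + 1 = n + n' by omega, Nat.mod_self]
      simp only [z, e, hl]
      rw [if_pos (Nat.zero_le _), h0]
      by_cases h : n' = 1
      · rw [if_pos (by omega), show n + n' - 1 = n by omega, h1, h]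
        exact (hf'.1 0 (by omega)).symm
      · rw [if_neg (by omega), show n + n' - (n + n' - 1) = 1 by omega]
        exact (hf'.1 0 (by omega)).symm
    · have e : (i + 1) % (n + n') = i % (n + n') + 1 := by
        rw [Nat.add_mod, Nat.mod_eq_of_lt (show 1 < n + n' by omega), Nat.mod_eq_of_lt]
        omega
      simp only [z, e]
      generalize i % (n + n') = a at *
      rcases lt_trichotomy a n with h | h | h
      · rw [if_pos (by omega), if_pos (by omega)]
        exact hf.1 a h
      · rw [if_pos (by omega), if_neg (by omega), h, h1]
        have := (hf'.1 (n' - 1) (by omega)).symm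
        rw [show n' - 1 + 1 = n' by omega] at this
        rw [show n + n' - (n + 1) = n' - 1 by omega]
        exact this
      · rw [if_neg (by omega), if_neg (by omega)]
        have := (hf'.1 (n + n' - (a + 1)) (by omega)).symm
        rwa [show n + n' - (a + 1) + 1 = n + n' - a by omega] at this
  have hper : ∀ i, z (i + (n + n')) = z i := fun i => by simp [z]
  have hinj : ∀ i < n + n', ∀ j < n + n', z i = z j → i = j := by
    intro i hi j hj he
    simp only [z, Nat.mod_eq_of_lt hi, Nat.mod_eq_of_lt hj] at he
    split_ifs at he with a b b
    · exact hf.2 _ a _ b he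
    · have := hd _ a _ (by omega) he; omega
    · have := hd _ b _ (by omega) he.symm; omega
    · have := hf'.2 _ (by omega) _ (by omega) he; omega
  refine ⟨z, ⟨hn, ?_, hadj, hper, hinj⟩, ?_⟩
  · intro i
    have e : z (i + (n + n' - 1) + 1) = z i := by
      rw [show i + (n + n' - 1) + 1 = i + (n + n') by omega, hper]
    refine ⟨z (i + 1), z (i + (n + n' - 1)), ?_, hadj i, ?_⟩
    · intro he
      have hz : ∀ j, z j = z (j % (n + n')) := fun j => by simp [z]
      rw [hz (i + 1), hz (i + (n + n' - 1))] at he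
      have := hinj _ (hlt _) _ (hlt _) he
      have h2 : 1 ≡ n + n' - 1 [MOD n + n'] := Nat.ModEq.add_left_cancel' i this
      rw [Nat.ModEq, Nat.mod_eq_of_lt (by omega), Nat.mod_eq_of_lt (by omega)] at h2
      omega
    · have := hadj (i + (n + n' - 1))
      rw [e] at this
      exact this.symm
  · intro i hi
    simp only [z, Nat.mod_eq_of_lt (show i < n + n' by omega), hi, if_true]

end ASC


namespace ASC

variable {V : Type*} {G : SimpleGraph V}

theorem geodesic_via (hc : G.Connected) {s a t : V} {d : ℕ} (hadj : G.Adj s a)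
    (hs : G.dist s t = d + 1) (ha : G.dist a t = d) :
    ∃ f : ℕ → V, Arc G f (d + 1) ∧ f 0 = s ∧ f 1 = a ∧ f (d + 1) = t ∧
      (∀ i ≤ d + 1, G.dist (f i) t = d + 1 - i) := by
  obtain ⟨f, h1, h2, h3, h4⟩ := geodesic hc t d a ha
  have h5 : ∀ i ≤ d + 1, G.dist ((fun i => if i = 0 then s else f (i - 1)) i) t = d + 1 - i := by
    intro i hi
    by_cases h0 : i = 0
    · simp [h0, hs]
    · simp only [h0, if_false]
      rw [h4 _ (by omega)]
      omega
  refine ⟨fun i => if i = 0 then s else f (i - 1), ⟨?_, ?_⟩, by simp, by simpa using h2,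
    by simpa using h3, h5⟩
  · intro i hi
    by_cases h0 : i = 0
    · simp [h0, h2, hadj]
    · simp only [h0, if_false, show i + 1 ≠ 0 by omega]
      have := h1.1 (i - 1) (by omega)
      rwa [show i - 1 + 1 = i + 1 - 1 by omega] at this
  · intro i hi j hj he
    have e1 := h5 i hi
    have e2 := h5 j hj
    rw [he] at e1
    omega

theorem odd_cycle {x y : V} {r k : ℕ} (h : Ctx G x y r) (hx : x ∈ Core G) (hr : r ≤ 2 * k)
    (hg : GirthGE G (4 * k + 1)) :
    r = 2 * k ∧ ∃ z, Cyc G z (4 * k + 2) ∧ z 0 = x ∧ z (2 * k + 1) = y := by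
  classical
  obtain ⟨a, b, hab, ha, hb⟩ := hx
  have key : ∀ a, G.Adj x a → G.dist a y = r := by
    intro a ha
    have e1 := h.conn.dist_triangle (u := x) (v := a) (w := y)
    rw [h.dxy, dist_eq_one_iff_adj.2 ha] at e1
    rcases h.le a y with h1 | h1 | h1
    · omega
    · exact absurd h1.1 ha.ne'
    · exact absurd h1.2.symm h.ne
  obtain ⟨f, f1, f2, f3, f4, f5⟩ := geodesic_via h.conn ha h.dxy (key a ha)
  obtain ⟨f', f1', f2', f3', f4', f5'⟩ := geodesic_via h.conn hb h.dxy (key b hb)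
  have hex : ∃ i, 1 ≤ i ∧ i ≤ r + 1 ∧ f i = f' i := ⟨r + 1, by omega, le_rfl, by rw [f4, f4']⟩
  obtain ⟨m1, m2, m3⟩ := Nat.find_spec hex
  have hmin := fun m (hm : m < Nat.find hex) => Nat.find_min hex hm
  generalize Nat.find hex = m at *
  have hm1 : m ≠ 1 := by
    rintro rfl
    rw [f3, f3'] at m3
    exact hab m3
  have hd : ∀ i ≤ m, ∀ j ≤ m, f i = f' j → (i = 0 ∧ j = 0) ∨ (i = m ∧ j = m) := by
    intro i hi j hj he
    have e1 := f5 i (by omega)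
    have e2 := f5' j (by omega)
    rw [he] at e1
    have : i = j := by omega
    subst this
    by_contra hno
    exact hmin i (by omega) ⟨by omega, by omega, he⟩
  have hsub := f1.sub 0 m (by omega)
  have hsub' := f1'.sub 0 m (by omega)
  simp only [Nat.zero_add] at hsub hsub'
  have e := close_arcs hg f f' m m hsub hsub' (by rw [f2, f2']) m3 (by omega) (by omega) hd
  have er : r = 2 * k := by omega
  have em : m = 2 * k + 1 := by omega
  refine ⟨er, ?_⟩
  obtain ⟨z, hz, hz'⟩ := cyc_of_arcs f f' m m hsub hsub' (by rw [f2, f2']) m3 (by omega) (by omega) hd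
  rw [show m + m = 4 * k + 2 by omega] at hz
  refine ⟨z, hz, by rw [hz' 0 (by omega), f2], ?_⟩
  rw [← em, hz' m le_rfl, show m = r + 1 by omega, f4]

theorem odd_off {x y : V} {k : ℕ} (h : Ctx G x y (2 * k)) (hk : 1 ≤ k)
    (hg : GirthGE G (4 * k + 1)) {z : ℕ → V} (hz : Cyc G z (4 * k + 2)) (h0 : z 0 = x)
    (h1 : z (2 * k + 1) = y) (i : ℕ) (hi0 : i ≠ 0) (hi1 : i ≠ 2 * k + 1) (hi : i < 4 * k + 2) :
    ∃ w, G.Adj (z i) w ∧ (∀ j, w ≠ z j) ∧ G.dist w (z (i + (2 * k + 1))) ≤ 2 * k - 1 := by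
  obtain ⟨w, w1, w2, w3⟩ := (hz.shift i).off_nbr h.conn hk hg (by
    rcases h.le (z (i + 0)) (z (i + (2 * k + 1))) with h2 | h2 | h2
    · exact h2
    · rw [← h0] at h2
      exact absurd (hz.inj i hi 0 (by omega) h2.1) hi0
    · rw [← h1] at h2
      exact absurd (hz.inj i hi _ (by omega) h2.1) hi1)
  refine ⟨w, w1, fun j => ?_, w3⟩
  have := w2 (j + (4 * k + 2) - i)
  rwa [show i + (j + (4 * k + 2) - i) = j + (4 * k + 2) by omega, hz.per] at this

theorem Cyc.card_image [DecidableEq V] {z : ℕ → V} {L : ℕ} (h : Cyc G z L) :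
    ((Finset.range L).image z).card = L := by
  rw [Finset.card_image_of_injOn, Finset.card_range]
  intro i hi j hj he
  simp at hi hj
  exact h.inj i hi j hj he

/-- a vertex off the cycle adjacent to two cycle vertices -/
theorem Cyc.off2' {z : ℕ → V} {L g : ℕ} (h : Cyc G z L) (hg : GirthGE G g) (a b : ℕ) (hab : a < b)
    (hb : b < L) (w : V) (hw : ∀ i, w ≠ z i) (h2 : G.Adj (z a) w) (h3 : G.Adj (z b) w) :
    g ≤ b - a + 2 ∧ g ≤ L - (b - a) + 2 := by
  have e1 := h.off2 hg a (b - a) (by omega) (by omega) w hw h2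
    (by rw [Nat.add_sub_cancel' hab.le]; exact h3.symm)
  have e2 := h.off2 hg b (a + L - b) (by omega) (by omega) w hw h3
    (by rw [show b + (a + L - b) = a + L by omega, h.per]; exact h2.symm)
  omega

theorem odd_two [Fintype V] {x y : V} {r : ℕ} (h : Ctx G x y r) (hx : x ∈ Core G) (hr : r ≤ 4)
    (hg : GirthGE G 9) (hn : Fintype.card V = 16) : False := by
  classical
  obtain ⟨rfl, z, hz, h0, h1⟩ := odd_cycle (k := 2) h hx hr hg
  have hoff := odd_off h (by omega) hg hz h0 h1
  have hoff' : ∀ i, ∃ w, (i ≠ 0 ∧ i ≠ 5 ∧ i < 10) → (G.Adj (z i) w ∧ (∀ j, w ≠ z j)) := by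
    intro i
    by_cases hi : i ≠ 0 ∧ i ≠ 5 ∧ i < 10
    · obtain ⟨w, w1, w2, -⟩ := hoff i hi.1 hi.2.1 hi.2.2
      exact ⟨w, fun _ => ⟨w1, w2⟩⟩
    · exact ⟨x, fun h => absurd h hi⟩
  choose w hw using hoff'
  have hlt : ∀ i j, i ≠ 0 → i ≠ 5 → j < 10 → j ≠ 5 → i < j → w i ≠ w j := by
    intro i j hi hi' hj hj' hij he
    have e1 := hw i ⟨hi, hi', by omega⟩
    have e2 := hw j ⟨by omega, hj', hj⟩
    have := hz.off2' hg i j hij (by omega) (w i) e1.2 e1.1 (by rw [he]; exact e2.1)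
    omega
  have hcard : ((Finset.range 10).image z ∪ ((Finset.range 10).erase 0 |>.erase 5).image w).card
      = 18 := by
    rw [Finset.card_union_of_disjoint, Finset.card_image_of_injOn (s := (Finset.range 10).erase 0
      |>.erase 5), hz.card_image]
    · rfl
    · intro i hi j hj he
      simp at hi hj
      rcases lt_trichotomy i j with hij | hij | hij
      · exact absurd he (hlt i j (by omega) (by omega) (by omega) (by omega) hij)
      · exact hij
      · exact absurd he.symm (hlt j i (by omega) (by omega) (by omega) (by omega) hij)
    · rw [Finset.disjoint_left]
      simp only [Finset.mem_image, Finset.mem_erase, Finset.mem_range]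
      rintro v ⟨i, hi, rfl⟩ ⟨j, hj, he⟩
      exact (hw j ⟨by omega, by omega, by omega⟩).2 i he
  have := Finset.card_le_univ ((Finset.range 10).image z ∪
    ((Finset.range 10).erase 0 |>.erase 5).image w)
  omega

theorem odd_one [Fintype V] {x y : V} {r : ℕ} (h : Ctx G x y r) (hx : x ∈ Core G) (hr : r ≤ 2)
    (hg : GirthGE G 5) (hn : Fintype.card V = 8) : False := by
  classical
  obtain ⟨rfl, z, hz, h0, h1⟩ := odd_cycle (k := 1) h hx hr hg
  have hadj : ∀ i, i ≠ 0 → i ≠ 3 → i < 6 →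
      ∃ w, (∀ j, w ≠ z j) ∧ G.Adj (z i) w ∧ G.Adj (z (i + 3)) w := by
    intro i hi hi' hi''
    obtain ⟨w, w1, w2, w3⟩ := odd_off h (by omega) hg hz h0 h1 i hi hi' hi''
    refine ⟨w, w2, w1, ?_⟩
    have := h.conn.pos_dist_of_ne (w2 (i + 3))
    exact (dist_eq_one_iff_adj.1 (show G.dist w (z (i + 3)) = 1 by
      simp only [Nat.mul_one] at w3
      norm_num at w3
      omega)).symm
  obtain ⟨p, p1, p2, p3⟩ := hadj 1 (by omega) (by omega) (by omega)
  obtain ⟨q, q1, q2, q3⟩ := hadj 2 (by omega) (by omega) (by omega)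
  norm_num at p3 q3
  have hpo : ∀ i < 6, G.Adj (z i) p → i = 1 ∨ i = 4 := by
    intro i hi hip
    by_contra hno
    rcases lt_trichotomy i 1 with hij | hij | hij
    · have := hz.off2' hg i 1 hij (by omega) p p1 hip p2
      omega
    · omega
    · have := hz.off2' hg 1 i hij (by omega) p p1 p2 hip
      omega
  have hqo : ∀ i < 6, G.Adj (z i) q → i = 2 ∨ i = 5 := by
    intro i hi hip
    by_contra hno
    rcases lt_trichotomy i 2 with hij | hij | hij
    · have := hz.off2' hg i 2 hij (by omega) q q1 hip q2
      omega
    · omega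
    · have := hz.off2' hg 2 i hij (by omega) q q1 q2 hip
      omega
  have hpq : p ≠ q := by
    rintro rfl
    have := hpo 2 (by omega) q2
    omega
  have hnadj : ¬ G.Adj p q := by
    intro hpqa
    have := hg (fun i => if i = 0 then p else if i = 1 then z 1 else if i = 2 then z 2 else q) 3
      (by omega) ⟨?_, ?_⟩ (by simpa using hpqa.symm)
    · omega
    · intro i hi
      interval_cases i
      · simpa using p2.symm
      · simpa using hz.adj 1
      · simpa using q2
    · have e := (hz.adj 1).ne
      have e1 := p1 1
      have e2 := p1 2
      have e3 := q1 1
      have e4 := q1 2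
      intro i hi j hj he
      interval_cases i <;> interval_cases j <;> first
        | rfl
        | (exfalso
           simp only [if_true, if_false, one_ne_zero, OfNat.ofNat_ne_zero, OfNat.ofNat_ne_one,
             Nat.reduceEqDiff] at he
           first
             | exact e he
             | exact e he.symm
             | exact e1 he
             | exact e1 he.symm
             | exact e2 he
             | exact e2 he.symm
             | exact e3 he
             | exact e3 he.symm
             | exact e4 he
             | exact e4 he.symm
             | exact hpq he
             | exact hpq he.symm)
  have hcov : ∀ w, w = p ∨ w = q ∨ ∃ i < 6, w = z i := by
    have hc : (insert p (insert q ((Finset.range 6).image z))).card = 8 := by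
      rw [Finset.card_insert_of_notMem, Finset.card_insert_of_notMem, hz.card_image]
      · simp only [Finset.mem_image, not_exists, not_and]
        exact fun i _ he => q1 i he.symm
      · simp only [Finset.mem_insert, Finset.mem_image, not_exists, not_and, not_or]
        exact ⟨hpq, fun i _ he => p1 i he.symm⟩
    have := Finset.eq_univ_of_card _ (hc.trans hn.symm)
    intro w
    have hw := Finset.mem_univ w
    rw [← this] at hw
    simp only [Finset.mem_insert, Finset.mem_image, Finset.mem_range] at hw
    rcases hw with hw | hw | ⟨i, hi, hw⟩
    · exact Or.inl hw
    · exact Or.inr (Or.inl hw)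
    · exact Or.inr (Or.inr ⟨i, hi, hw.symm⟩)
  have hd : G.dist p q ≤ 2 := by
    rcases h.le p q with h2 | h2 | h2
    · exact h2
    · exact absurd (h2.1.trans h0.symm) (p1 _)
    · exact absurd (h2.2.trans h0.symm) (q1 _)
  obtain ⟨c, c1, c2⟩ := exists_adj_dist h.conn hpq
  have hcq : c ≠ q := by
    rintro rfl
    exact hnadj c1
  have c3 : G.Adj c q := by
    have := h.conn.pos_dist_of_ne hcq
    exact dist_eq_one_iff_adj.1 (by omega)
  rcases hcov c with rfl | rfl | ⟨i, hi, rfl⟩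
  · exact c1.ne rfl
  · exact hcq rfl
  · have := hpo i hi c1.symm
    have := hqo i hi c3
    omega

theorem odd_false [Fintype V] {x y : V} {r k : ℕ} (h : Ctx G x y r) (hx : x ∈ Core G)
    (hr : r ≤ 2 * k) (hg : GirthGE G (4 * k + 1))
    (hn : (k = 1 ∧ Fintype.card V = 8) ∨ (k = 2 ∧ Fintype.card V = 16)) : False := by
  rcases hn with ⟨rfl, hn⟩ | ⟨rfl, hn⟩
  · exact odd_one h hx hr hg hn
  · exact odd_two h hx hr hg hn

end ASC


namespace ASC

variable {V : Type*} {G : SimpleGraph V}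

theorem third' (β γ : Fin 3) (h : β ≠ γ) : ∃ δ, β ≠ δ ∧ γ ≠ δ ∧
    (∀ f : Fin 3 → ℕ, f β + f γ + f δ = f 0 + f 1 + f 2) ∧ ∀ x, x = β ∨ x = γ ∨ x = δ := by
  fin_cases β <;> fin_cases γ
  · exact absurd rfl h
  · exact ⟨2, by decide, by decide, fun f => by simp, by decide⟩
  · exact ⟨1, by decide, by decide, fun f => by simp; omega, by decide⟩
  · exact ⟨2, by decide, by decide, fun f => by simp; omega, by decide⟩
  · exact absurd rfl h
  · exact ⟨0, by decide, by decide, fun f => by simp; omega, by decide⟩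
  · exact ⟨1, by decide, by decide, fun f => by simp; omega, by decide⟩
  · exact ⟨0, by decide, by decide, fun f => by simp; omega, by decide⟩
  · exact absurd rfl h

theorem third (β : Fin 3) : ∃ γ δ, β ≠ γ ∧ β ≠ δ ∧ γ ≠ δ ∧
    (∀ f : Fin 3 → ℕ, f β + f γ + f δ = f 0 + f 1 + f 2) ∧ ∀ x, x = β ∨ x = γ ∨ x = δ := by
  have : ∃ γ, β ≠ γ := by
    fin_cases β
    · exact ⟨1, by decide⟩
    · exact ⟨0, by decide⟩
    · exact ⟨0, by decide⟩
  obtain ⟨γ, h⟩ := this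
  obtain ⟨δ, h1, h2, h3⟩ := third' β γ h
  exact ⟨γ, δ, h, h1, h2, h3⟩

/-- numeric hypotheses on the order -/
structure Num (N k : ℕ) : Prop where
  ev : N % 2 = 0
  k1 : 1 ≤ k
  lo : 6 * k ≤ N
  hi : N ≤ 6 * k + 4
  ten : N ≠ 10

theorem Theta.same_false [Fintype V] {P : Fin 3 → ℕ → V} {L : Fin 3 → ℕ} {u v : V}
    (h : Theta G P L u v) {k : ℕ} (hg : GirthGE G (4 * k + 1)) (hN : Num (Fintype.card V) k)
    {q : ℕ → V} {l : ℕ} (hq : Ear G P L q l) (β : Fin 3) (i j : ℕ) (hij : i < j)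
    (hj : j ≤ L β) (h0 : q 0 = P β i) (h1 : q l = P β j) : False := by
  classical
  obtain ⟨γ, δ, n1, n2, n3, hs, -⟩ := third β
  have e1 := h.ear_same1 hg hq β i j hij hj h0 h1
  have e2 := h.ear_same2 hg hq β i j hij hj h0 h1 γ n1
  have e3 := h.ear_same2 hg hq β i j hij hj h0 h1 δ n2
  have e4 := h.pair hg β γ n1
  have e5 := h.pair hg β δ n2
  have e6 := h.pair hg γ δ n3
  have e7 := h.ear_card hq
  have e8 := Finset.card_le_univ (TV P L ∪ (Finset.Ioo 0 l).image q)
  have e9 := hs L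
  obtain ⟨a1, a2, a3, a4, a5⟩ := hN
  omega

theorem Theta.dist_le {P : Fin 3 → ℕ → V} {L : Fin 3 → ℕ} {u v : V}
    (h : Theta G P L u v) (β : Fin 3) (i j : ℕ) (hij : i ≤ j) (hj : j ≤ L β) :
    G.dist (P β i) (P β j) ≤ j - i :=
  dist_seq_le _ _ (h.arc β).1 i j hij hj

theorem Theta.diff_false [Fintype V] {P : Fin 3 → ℕ → V} {L : Fin 3 → ℕ} {u v : V}
    (h : Theta G P L u v) {k : ℕ} (hg : GirthGE G (4 * k + 1)) (hN : Num (Fintype.card V) k)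
    {x y : V} {r : ℕ} (hX : Ctx G x y r) {q : ℕ → V} (hqc : ∀ i, q i ∈ Core G)
    {l : ℕ} (hq : Ear G P L q l) (β γ : Fin 3) (hne : β ≠ γ)
    (i j : ℕ) (hi0 : 0 < i) (hi : i < L β) (hj0 : 0 < j) (hj : j < L γ) (h0 : q 0 = P β i)
    (h1 : q l = P γ j) : False := by
  classical
  obtain ⟨δ, n1, n2, hs, hall⟩ := third' β γ hne
  have e1 := h.ear_diff hg hq β γ hne i j hi0 hi hj0 hj h0 h1
  have e2 := h.rev.ear_diff hg hq.trev β γ hne (L β - i) (L γ - j) (by omega) (by omega) (by omega)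
    (by omega) (by rw [h0]; congr 1; omega) (by rw [h1]; congr 1; omega)
  have e4 := h.pair hg β γ hne
  have e5 := h.pair hg β δ n1
  have e6 := h.pair hg γ δ n2
  have e7 := h.ear_card hq
  have e8 := Finset.card_le_univ (TV P L ∪ (Finset.Ioo 0 l).image q)
  have e9 := hs L
  obtain ⟨a1, a2, a3, a4, a5⟩ := hN
  have hkn : (k = 1 ∧ Fintype.card V = 8) ∨ (k = 2 ∧ Fintype.card V = 16) := by omega
  have huniv := Finset.eq_univ_of_card _ (show
    (TV P L ∪ (Finset.Ioo 0 l).image q).card = Fintype.card V by omega)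
  have hcov : ∀ w, (∃ β, ∃ i ≤ L β, w = P β i) ∨ ∃ t, 0 < t ∧ t < l ∧ w = q t := by
    intro w
    have hw := Finset.mem_univ w
    rw [← huniv, Finset.mem_union, h.mem_TV] at hw
    rcases hw with hw | hw
    · exact Or.inl hw
    · simp only [Finset.mem_image, Finset.mem_Ioo] at hw
      obtain ⟨t, ht, he⟩ := hw
      exact Or.inr ⟨t, ht.1, ht.2, he.symm⟩
  have hpath : ∀ (β γ : Fin 3) (i : ℕ), i ≤ L β → L β + L γ = 4 * k + 1 →
      G.dist u (P β i) ≤ 2 * k := by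
    intro β γ i hi hs
    have d1 := h.dist_le β 0 i (by omega) hi
    have d2 := h.dist_le β i (L β) hi le_rfl
    have d3 := h.dist_le γ 0 (L γ) (by omega) le_rfl
    rw [h.start] at d1 d3
    rw [h.last] at d2 d3
    have d4 := hX.conn.dist_triangle (u := u) (v := v) (w := P β i)
    rw [G.dist_comm] at d2
    omega
  have hecc : ∀ w, G.dist u w ≤ 2 * k := by
    intro w
    rcases hcov w with ⟨ε, t, ht, rfl⟩ | ⟨t, t1, t2, rfl⟩
    · rcases hall ε with rfl | rfl | rfl
      · exact hpath _ δ t ht (by omega)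
      · exact hpath _ δ t ht (by omega)
      · exact hpath _ β t ht (by omega)
    · have d1 := h.dist_le β 0 i (by omega) hi.le
      have d2 := h.dist_le γ 0 j (by omega) hj.le
      rw [h.start] at d1 d2
      have d3 := dist_seq_le q l hq.arc.1 0 t (by omega) (by omega)
      have d4 := dist_seq_le q l hq.arc.1 t l (by omega) (by omega)
      rw [h0] at d3
      rw [h1, G.dist_comm] at d4
      have d5 := hX.conn.dist_triangle (u := u) (v := P β i) (w := q t)
      have d6 := hX.conn.dist_triangle (u := u) (v := P γ j) (w := q t)
      omega
  have hcore : ∀ w, w ∈ Core G := by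
    intro w
    rcases hcov w with ⟨ε, t, ht, rfl⟩ | ⟨t, t1, t2, rfl⟩
    · exact h.core _ _ ht
    · exact hqc t
  refine odd_false hX (hcore x) ?_ hg hkn
  by_cases hux : u = x
  · have := hecc y
    rw [hux, hX.dxy] at this
    omega
  · by_cases huy : u = y
    · have := hecc x
      rw [huy, G.dist_comm, hX.dxy] at this
      omega
    · obtain ⟨t, ht⟩ := hX.ecc u hux huy
      rw [← ht]
      exact hecc t

theorem Theta.ear_false [Fintype V] {P : Fin 3 → ℕ → V} {L : Fin 3 → ℕ} {u v : V}
    (h : Theta G P L u v) {k : ℕ} (hg : GirthGE G (4 * k + 1)) (hN : Num (Fintype.card V) k)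
    {x y : V} {r : ℕ} (hX : Ctx G x y r) {q : ℕ → V} (hqc : ∀ i, q i ∈ Core G)
    {l : ℕ} (hq : Ear G P L q l) (β γ : Fin 3)
    (i j : ℕ) (hi : i ≤ L β) (hj : j ≤ L γ) (h0 : q 0 = P β i)
    (h1 : q l = P γ j) : False := by
  have hp := hq.pos
  have hends : q 0 ≠ q l := fun he => by
    have := hq.arc.2 0 (by omega) l le_rfl he
    omega
  have same : ∀ (β : Fin 3) (i j : ℕ), i ≤ L β → j ≤ L β → q 0 = P β i → q l = P β j → False := by
    intro β i j hi hj h0 h1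
    rcases lt_trichotomy i j with hij | hij | hij
    · exact h.same_false hg hN hq β i j hij hj h0 h1
    · rw [h0, h1, hij] at hends
      exact hends rfl
    · exact h.same_false hg hN hq.rev β j i hij hi (by simpa using h1) (by simpa using h0)
  by_cases hne : β = γ
  · subst hne
    exact same β i j hi hj h0 h1
  by_cases hi0 : i = 0
  · exact same γ 0 j (by omega) hj (by rw [h0, hi0, h.start, h.start]) h1
  by_cases hi1 : i = L β
  · exact same γ (L γ) j le_rfl hj (by rw [h0, hi1, h.last, h.last]) h1
  by_cases hj0 : j = 0
  · exact same β i 0 hi (by omega) h0 (by rw [h1, hj0, h.start, h.start])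
  by_cases hj1 : j = L γ
  · exact same β i (L β) hi le_rfl h0 (by rw [h1, hj1, h.last, h.last])
  exact h.diff_false hg hN hX hqc hq β γ hne i j (by omega) (by omega) (by omega) (by omega) h0 h1

/-- In our situation a theta contains all core edges at its vertices. -/
theorem Theta.closed [Fintype V] {P : Fin 3 → ℕ → V} {L : Fin 3 → ℕ} {u v : V}
    (h : Theta G P L u v) {k : ℕ} (hg : GirthGE G (4 * k + 1)) (hN : Num (Fintype.card V) k)
    {x y : V} {r : ℕ} (hX : Ctx G x y r) (hr : 2 ≤ r) (β : Fin 3) (i : ℕ) (hi : i ≤ L β) (w : V)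
    (hw : w ∈ Core G) (hadj : G.Adj (P β i) w) : TE P L (P β i) w := by
  classical
  by_contra hTE
  have e4 := h.pair hg 0 1 (by decide)
  have e5 := h.pair hg 0 2 (by decide)
  have e6 := h.pair hg 1 2 (by decide)
  have e7 := h.card_TV
  have a1 := hN.hi
  have a2 := hN.lo
  have a3 := hN.k1
  obtain ⟨q, m, q1, q2, q3, q4, q5, q6, q7⟩ := ear hg (Core G) (hX.core_nb hr (by omega)) (TV P L)
    (by omega) (P β i) w (h.core β i hi) hw hadj
  rw [h.mem_TV] at q6
  obtain ⟨γ, j, hj, q6⟩ := q6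
  refine h.ear_false hg hN hX q5 (l := m) ⟨q2, q1, ?_, ?_⟩ β γ i j hi hj q3 q6
  · intro t t1 t2 ε s hs he
    exact q7 t t1 t2 ((h.mem_TV _).2 ⟨ε, s, hs, he⟩)
  · rintro ⟨rfl, hh⟩
    rw [q3, q4] at hh
    exact hTE hh

/-- existence of a theta -/
theorem exists_theta [Fintype V] {k : ℕ} (hg : GirthGE G (4 * k + 1)) (hN : Num (Fintype.card V) k)
    {x y : V} {r : ℕ} (hX : Ctx G x y r) (hr : 2 ≤ r) : ∃ P L u v, Theta G P L u v := by
  classical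
  obtain ⟨a1, a2, a3, a4, a5⟩ := hN
  obtain ⟨a, ha, b, hb, hab⟩ := hX.exists_core_edge hr (by omega)
  obtain ⟨z, L, z1, z2, z3, z4, z5, z6⟩ := exists_cycle hg (Core G) (hX.core_nb hr (by omega)) a b
    ha hb hab
  have hz : Cyc G z L := ⟨z1, z3, z4, z5, z6⟩
  by_cases honly : ∀ i, ∀ w ∈ Core G, G.Adj (z i) w → w = z (i + 1) ∨ w = z (i + L - 1)
  · exact (uni_false hX hr (by omega) (by rw [Nat.even_iff]; exact a1) ⟨hz, honly⟩).elim
  push Not at honly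
  obtain ⟨i, w, hw, hiw, hw1, hw2⟩ := honly
  have hz' := hz.shift i
  rw [show i + L - 1 = i + (L - 1) by omega] at hw2
  rw [show z i = z (i + 0) from rfl] at hiw
  generalize hzd : (fun j => z (i + j)) = y at *
  have hy : ∀ j, z (i + j) = y j := fun j => by rw [← hzd]
  rw [hy] at hiw hw1 hw2
  clear hzd hy hz z1 z3 z4 z5 z6
  obtain ⟨q, m, q1, q2, q3, q4, q5, q6, q7⟩ := ear hg (Core G) (hX.core_nb hr (by omega))
    ((Finset.range L).image y) (by rw [hz'.card_image]; omega) (y 0) w (hz'.core 0) hw hiw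
  simp only [Finset.mem_image, Finset.mem_range] at q6 q7
  obtain ⟨j, hj, hjq⟩ := q6
  have hoff : ∀ t, 0 < t → t < m → ∀ s ≤ L, q t ≠ y s := by
    intro t t1 t2 s hs he
    refine q7 t t1 t2 ⟨s % L, Nat.mod_lt _ (by omega), ?_⟩
    rw [he, ← hz'.mod]
  have hj0 : j ≠ 0 := by
    rintro rfl
    have := q2.2 0 (by omega) m le_rfl (by rw [q3, hjq])
    omega
  have yL : y L = y 0 := by simpa using hz'.per 0
  have hinj : ∀ a ≤ L, ∀ b ≤ L, y a = y b → a = b ∨ (a = 0 ∧ b = L) ∨ (a = L ∧ b = 0) := by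
    intro a ha b hb he
    by_cases haL : a = L <;> by_cases hbL : b = L
    · omega
    · rw [haL, yL] at he
      have := hz'.inj 0 (by omega) b (by omega) he
      omega
    · rw [hbL, yL] at he
      have := hz'.inj a (by omega) 0 (by omega) he
      omega
    · exact Or.inl (hz'.inj a (by omega) b (by omega) he)
  have hd01 : ∀ a ≤ j, ∀ b ≤ L - j, y a = y (L - b) → (a = 0 ∧ b = 0) ∨ (a = j ∧ b = L - j) := by
    intro a ha b hb he
    have := hinj a (by omega) (L - b) (by omega) he
    omega
  have hq' : ∀ t ≤ m, ∀ s ≤ L, q t = y s → (t = 0 ∧ (s = 0 ∨ s = L)) ∨ (t = m ∧ s = j) := by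
    intro t ht s hs he
    by_cases ht0 : t = 0
    · rw [ht0, q3] at he
      have := hinj 0 (by omega) s hs he
      omega
    · by_cases htm : t = m
      · rw [htm, ← hjq] at he
        have := hinj j (by omega) s hs he
        omega
      · exact absurd he (hoff t (by omega) (by omega) s hs)
  have hd20 : ∀ t ≤ m, ∀ a ≤ j, q t = y a → (t = 0 ∧ a = 0) ∨ (t = m ∧ a = j) := by
    intro t ht a ha he
    have := hq' t ht a (by omega) he
    omega
  have hd21 : ∀ t ≤ m, ∀ b ≤ L - j, q t = y (L - b) → (t = 0 ∧ b = 0) ∨ (t = m ∧ b = L - j) := by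
    intro t ht a ha he
    have := hq' t ht _ (by omega) he
    omega
  have s20 : 3 ≤ m + j := by
    by_contra hlt
    have e1 : m = 1 := by omega
    have e2 : j = 1 := by omega
    rw [e1, e2, q4] at hjq
    exact hw1 hjq.symm
  have s21 : 3 ≤ m + (L - j) := by
    by_contra hlt
    have e1 : m = 1 := by omega
    have e2 : j = L - 1 := by omega
    rw [e1, e2, q4] at hjq
    exact hw2 hjq.symm
  have ay : Arc G y j := by simpa using hz'.arc 0 j hj
  have ay' : Arc G (fun b => y (L - b)) (L - j) := by
    have := (hz'.arc j (L - j) (by omega)).rev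
    refine ⟨fun a ha => ?_, fun a ha b hb he => ?_⟩
    · have := this.1 a ha
      simp only at this ⊢
      rwa [show j + (L - j - a) = L - a by omega, show j + (L - j - (a + 1)) = L - (a + 1) by omega]
        at this
    · refine this.2 a ha b hb ?_
      simp only at he ⊢
      rwa [show j + (L - j - a) = L - a by omega, show j + (L - j - b) = L - b by omega]
  refine ⟨![y, fun b => y (L - b), q], ![j, L - j, m], y 0, y j, ?_, ?_, ?_, ?_, ?_, ?_, ?_⟩
  · intro β
    fin_cases β
    · rfl
    · simpa using yL
    · simpa using q3
  · intro β
    fin_cases β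
    · rfl
    · simp only [Fin.mk_one, Matrix.cons_val_one, Matrix.cons_val_zero]
      congr 1
      omega
    · simpa using hjq.symm
  · intro β
    fin_cases β
    · simp
      omega
    · simp
      omega
    · simpa using q1
  · intro β
    fin_cases β
    · simpa using ay
    · simpa using ay'
    · simpa using q2
  · intro β
    fin_cases β
    · simpa using fun i _ => hz'.core i
    · simpa using fun i _ => hz'.core (L - i)
    · simpa using fun i _ => q5 i
  · intro β γ hne
    fin_cases β <;> fin_cases γ
    · exact absurd rfl hne
    · simp
      omega
    · simp
      omega
    · simp
      omega
    · exact absurd rfl hne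
    · simp
      omega
    · simp
      omega
    · simp
      omega
    · exact absurd rfl hne
  · intro β γ hne
    fin_cases β <;> fin_cases γ
    · exact absurd rfl hne
    · exact hd01
    · exact fun a ha b hb he => (hd20 b hb a ha he.symm).imp And.symm And.symm
    · exact fun a ha b hb he => (hd01 b hb a ha he.symm).imp And.symm And.symm
    · exact absurd rfl hne
    · exact fun a ha b hb he => (hd21 b hb a ha he.symm).imp And.symm And.symm
    · exact hd20
    · exact hd21
    · exact absurd rfl hne

end ASC


namespace ASC

variable {V : Type*} {G : SimpleGraph V}

/-- A theta which carries the whole core. -/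
structure Full (G : SimpleGraph V) (P : Fin 3 → ℕ → V) (L : Fin 3 → ℕ) (u v : V) : Prop
    extends Theta G P L u v where
  conn : G.Connected
  closed : ∀ β, ∀ i ≤ L β, ∀ w ∈ Core G, G.Adj (P β i) w → TE P L (P β i) w

theorem Full.cover {P : Fin 3 → ℕ → V} {L : Fin 3 → ℕ} {u v : V} (h : Full G P L u v) :
    ∀ w ∈ Core G, ∃ β, ∃ i ≤ L β, w = P β i := by
  refine ASC.cover h.conn {w | ∃ β, ∃ i ≤ L β, w = P β i} (P 0 0) ⟨0, 0, by omega, rfl⟩ ?_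
  rintro v ⟨β, i, hi, rfl⟩ w hw hadj
  obtain ⟨γ, t, ht, h1 | h1⟩ := h.closed β i hi w hw hadj
  · exact ⟨γ, t + 1, by omega, h1.2⟩
  · exact ⟨γ, t, by omega, h1.1⟩

theorem Full.dist_ge {P : Fin 3 → ℕ → V} {L : Fin 3 → ℕ} {u v : V} (h : Full G P L u v)
    (β γ δ : Fin 3) (n1 : β ≠ γ) (n2 : β ≠ δ) (hall : ∀ x, x = β ∨ x = γ ∨ x = δ)
    (i : ℕ) (hi : i ≤ L β) (A B : ℕ) (hA : A = min i (L β - i + min (L γ) (L δ)))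
    (hB : B = min (L β - i) (i + min (L γ) (L δ))) :
    ∀ ε, ∀ t ≤ L ε, min (A + t) (B + (L ε - t)) ≤ G.dist (P β i) (P ε t) ∨
      (ε = β ∧ (i - t) + (t - i) ≤ G.dist (P β i) (P ε t)) := by
  let D : Fin 3 → ℕ → ℕ := fun ε t => if ε = β then min ((i - t) + (t - i)) (min (A + t) (B + (L β - t)))
    else min (A + t) (B + (L ε - t))
  have hDβ : ∀ t, D β t = min ((i - t) + (t - i)) (min (A + t) (B + (L β - t))) := fun t => by
    simp [D]
  have hDε : ∀ ε, ε ≠ β → ∀ t, D ε t = min (A + t) (B + (L ε - t)) := fun ε hε t => by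
    simp [D, hε]
  have hD0 : ∀ ε, D ε 0 = A := by
    intro ε
    rcases hall ε with rfl | rfl | rfl
    · rw [hDβ]; omega
    · rw [hDε _ n1.symm]; omega
    · rw [hDε _ n2.symm]; omega
  have hD1 : ∀ ε, D ε (L ε) = B := by
    intro ε
    rcases hall ε with rfl | rfl | rfl
    · rw [hDβ]; omega
    · rw [hDε _ n1.symm]; omega
    · rw [hDε _ n2.symm]; omega
  have hstep : ∀ ε, ∀ t < L ε, D ε t ≤ D ε (t + 1) + 1 ∧ D ε (t + 1) ≤ D ε t + 1 := by
    intro ε t ht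
    by_cases he : ε = β
    · subst he
      rw [hDβ, hDβ]
      omega
    · rw [hDε _ he, hDε _ he]
      omega
  have hwd : ∀ ε, ∀ t ≤ L ε, ∀ ε', ∀ t' ≤ L ε', P ε t = P ε' t' → D ε t = D ε' t' := by
    intro ε t ht ε' t' ht' he
    by_cases hne : ε = ε'
    · subst hne
      rw [(h.arc ε).2 t ht t' ht' he]
    · rcases h.inj ε ε' hne t ht t' ht' he with ⟨rfl, rfl⟩ | ⟨rfl, rfl⟩
      · rw [hD0, hD0]
      · rw [hD1, hD1]
  have main := lips_core h.conn (fun w m => ∃ ε, ∃ t ≤ L ε, w = P ε t ∧ m = D ε t) (P β i)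
    (h.core β i hi) (by
      rintro m ⟨ε, t, ht, he, rfl⟩
      rw [← hwd β i hi ε t ht he, hDβ]
      omega) (by
      rintro a ha w hw m hadj ⟨ε, t, ht, rfl, rfl⟩
      obtain ⟨γ, s, hs, h1 | h1⟩ := h.closed ε t ht a ha hadj.symm
      · refine ⟨_, ⟨γ, s + 1, by omega, h1.2, rfl⟩, ?_⟩
        rw [hwd ε t ht γ s (by omega) h1.1]
        exact (hstep γ s hs).1
      · refine ⟨_, ⟨γ, s, by omega, h1.1, rfl⟩, ?_⟩
        rw [hwd ε t ht γ (s + 1) (by omega) h1.2]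
        exact (hstep γ s hs).2)
  intro ε t ht
  have hm := main (P ε t) (h.core ε t ht) _ ⟨ε, t, ht, rfl, rfl⟩
  by_cases he : ε = β
  · subst he
    rw [hDβ] at hm
    omega
  · rw [hDε _ he] at hm
    exact Or.inl hm

theorem Full.same {P : Fin 3 → ℕ → V} {L : Fin 3 → ℕ} {u v : V} (h : Full G P L u v)
    (β γ δ : Fin 3) (n1 : β ≠ γ) (n2 : β ≠ δ) (hall : ∀ x, x = β ∨ x = γ ∨ x = δ)
    (i j : ℕ) (hij : i ≤ j) (hj : j ≤ L β) :
    G.dist (P β i) (P β j) = min (j - i) (i + (L β - j) + min (L γ) (L δ)) := by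
  have e1 := h.dist_ge β γ δ n1 n2 hall i (by omega) _ _ rfl rfl β j hj
  have d0 := h.dist_le β i j hij hj
  have d1 := h.dist_le β 0 i (by omega) (by omega)
  have d2 := h.dist_le β j (L β) hj le_rfl
  have d3 := h.dist_le γ 0 (L γ) (by omega) le_rfl
  have d4 := h.dist_le δ 0 (L δ) (by omega) le_rfl
  rw [h.start] at d1 d3 d4
  rw [h.last] at d2 d3 d4
  rw [G.dist_comm] at d1 d2
  have t1 := h.conn.dist_triangle (u := P β i) (v := u) (w := P β j)
  have t2 := h.conn.dist_triangle (u := u) (v := v) (w := P β j)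
  omega

theorem Full.diff {P : Fin 3 → ℕ → V} {L : Fin 3 → ℕ} {u v : V} (h : Full G P L u v)
    (β γ δ : Fin 3) (n1 : β ≠ γ) (n2 : β ≠ δ) (hall : ∀ x, x = β ∨ x = γ ∨ x = δ)
    (i j : ℕ) (hi : i ≤ L β) (hj : j ≤ L γ) :
    G.dist (P β i) (P γ j) = min (min (i + j) (L β - i + (L γ - j)))
      (min (i + L δ + (L γ - j)) (L β - i + L δ + j)) := by
  have e1 := h.dist_ge β γ δ n1 n2 hall i (by omega) _ _ rfl rfl γ j hj
  have d1 := h.dist_le β 0 i (by omega) (by omega)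
  have d2 := h.dist_le β i (L β) hi le_rfl
  have d3 := h.dist_le γ 0 j (by omega) hj
  have d4 := h.dist_le γ j (L γ) hj le_rfl
  have d5 := h.dist_le δ 0 (L δ) (by omega) le_rfl
  rw [h.start] at d1 d3 d5
  rw [h.last] at d2 d4 d5
  rw [G.dist_comm] at d1 d4
  have t1 := h.conn.dist_triangle (u := P β i) (v := u) (w := P γ j)
  have t2 := h.conn.dist_triangle (u := P β i) (v := v) (w := P γ j)
  have t3 := h.conn.dist_triangle (u := u) (v := v) (w := P γ j)
  have t4 := h.conn.dist_triangle (u := v) (v := u) (w := P γ j)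
  have t5 := G.dist_comm (u := u) (v := v)
  have n3 : γ ≠ β := n1.symm
  rcases e1 with e1 | e1
  · omega
  · exact absurd e1.1 n3

/-- The situation with sorted branches and explicit distances. -/
structure Sit (G : SimpleGraph V) (p q s : ℕ → V) (a b c : ℕ) : Prop where
  ab : a ≤ b
  bc : b ≤ c
  p0 : p 0 = s 0
  q0 : q 0 = s 0
  p1 : p a = s c
  q1 : q b = s c
  pc : ∀ i ≤ a, p i ∈ Core G
  qc : ∀ i ≤ b, q i ∈ Core G
  sc : ∀ i ≤ c, s i ∈ Core G
  cov : ∀ w ∈ Core G, (∃ i ≤ a, w = p i) ∨ (∃ i ≤ b, w = q i) ∨ (∃ i ≤ c, w = s i)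
  pi : ∀ i ≤ a, ∀ j ≤ a, p i = p j → i = j
  qi : ∀ i ≤ b, ∀ j ≤ b, q i = q j → i = j
  si : ∀ i ≤ c, ∀ j ≤ c, s i = s j → i = j
  pqi : ∀ i ≤ a, ∀ j ≤ b, p i = q j → (i = 0 ∧ j = 0) ∨ (i = a ∧ j = b)
  psi : ∀ i ≤ a, ∀ j ≤ c, p i = s j → (i = 0 ∧ j = 0) ∨ (i = a ∧ j = c)
  qsi : ∀ i ≤ b, ∀ j ≤ c, q i = s j → (i = 0 ∧ j = 0) ∨ (i = b ∧ j = c)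
  pp : ∀ i j, i ≤ j → j ≤ a → G.dist (p i) (p j) = min (j - i) (i + (a - j) + b)
  qq : ∀ i j, i ≤ j → j ≤ b → G.dist (q i) (q j) = min (j - i) (i + (b - j) + a)
  ss : ∀ i j, i ≤ j → j ≤ c → G.dist (s i) (s j) = min (j - i) (i + (c - j) + a)
  pq : ∀ i j, i ≤ a → j ≤ b → G.dist (p i) (q j) =
    min (min (i + j) (a - i + (b - j))) (min (i + c + (b - j)) (a - i + c + j))
  ps : ∀ i j, i ≤ a → j ≤ c → G.dist (p i) (s j) =
    min (min (i + j) (a - i + (c - j))) (min (i + b + (c - j)) (a - i + b + j))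
  qs : ∀ i j, i ≤ b → j ≤ c → G.dist (q i) (s j) =
    min (min (i + j) (b - i + (c - j))) (min (i + a + (c - j)) (b - i + a + j))

theorem Full.sit {P : Fin 3 → ℕ → V} {L : Fin 3 → ℕ} {u v : V} (h : Full G P L u v)
    (h01 : L 0 ≤ L 1) (h12 : L 1 ≤ L 2) : Sit G (P 0) (P 1) (P 2) (L 0) (L 1) (L 2) where
  ab := h01
  bc := h12
  p0 := by rw [h.start, h.start]
  q0 := by rw [h.start, h.start]
  p1 := by rw [h.last, h.last]
  q1 := by rw [h.last, h.last]
  pc := h.core 0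
  qc := h.core 1
  sc := h.core 2
  cov w hw := by
    obtain ⟨β, i, hi, he⟩ := h.cover w hw
    match β with
    | 0 => exact Or.inl ⟨i, hi, he⟩
    | 1 => exact Or.inr (Or.inl ⟨i, hi, he⟩)
    | 2 => exact Or.inr (Or.inr ⟨i, hi, he⟩)
  pi := (h.arc 0).2
  qi := (h.arc 1).2
  si := (h.arc 2).2
  pqi := h.inj 0 1 (by decide)
  psi := h.inj 0 2 (by decide)
  qsi := h.inj 1 2 (by decide)
  pp i j hij hj := by
    have := h.same 0 1 2 (by decide) (by decide) (by decide) i j hij hj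
    rwa [min_eq_left h12] at this
  qq i j hij hj := by
    have := h.same 1 0 2 (by decide) (by decide) (by decide) i j hij hj
    rwa [min_eq_left (h01.trans h12)] at this
  ss i j hij hj := by
    have := h.same 2 0 1 (by decide) (by decide) (by decide) i j hij hj
    rwa [min_eq_left h01] at this
  pq i j hi hj := h.diff 0 1 2 (by decide) (by decide) (by decide) i j hi hj
  ps i j hi hj := h.diff 0 2 1 (by decide) (by decide) (by decide) i j hi hj
  qs i j hi hj := h.diff 1 2 0 (by decide) (by decide) (by decide) i j hi hj

theorem exists_sit [Fintype V] {k : ℕ} (hg : GirthGE G (4 * k + 1)) (hN : Num (Fintype.card V) k)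
    {x y : V} {r : ℕ} (hX : Ctx G x y r) (hr : 2 ≤ r) : ∃ p q s a b c, Sit G p q s a b c ∧
      4 * k + 1 ≤ a + b ∧ ∃ K : Finset V, (∀ w, w ∈ K ↔ w ∈ Core G) ∧ K.card + 1 = a + b + c := by
  classical
  obtain ⟨P, L, u, v, h⟩ := exists_theta hg hN hX hr
  have h' := h.perm (Tuple.sort L)
  have hm := Tuple.monotone_sort L
  have hF : Full G (fun β => P (Tuple.sort L β)) (fun β => L (Tuple.sort L β)) u v :=
    ⟨h', hX.conn, h'.closed hg hN hX hr⟩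
  refine ⟨_, _, _, _, _, _, hF.sit (hm (by decide)) (hm (by decide)), h'.pair hg 0 1 (by decide),
    TV (fun β => P (Tuple.sort L β)) (fun β => L (Tuple.sort L β)), ?_, h'.card_TV⟩
  intro w
  rw [h'.mem_TV]
  constructor
  · rintro ⟨β, i, hi, rfl⟩
    exact h'.core β i hi
  · exact hF.cover w

end ASC


namespace ASC

variable {V : Type*} {G : SimpleGraph V}

theorem Sit.rev {p q s : ℕ → V} {a b c : ℕ} (h : Sit G p q s a b c) :
    Sit G (fun i => p (a - i)) (fun i => q (b - i)) (fun i => s (c - i)) a b c where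
  ab := h.ab
  bc := h.bc
  p0 := by simpa using h.p1
  q0 := by simpa using h.q1
  p1 := by simpa using h.p0
  q1 := by simpa using h.q0
  pc i _ := h.pc _ (by omega)
  qc i _ := h.qc _ (by omega)
  sc i _ := h.sc _ (by omega)
  cov w hw := by
    rcases h.cov w hw with ⟨i, hi, he⟩ | ⟨i, hi, he⟩ | ⟨i, hi, he⟩
    · exact Or.inl ⟨a - i, by omega, by rw [he]; congr 1; omega⟩
    · exact Or.inr (Or.inl ⟨b - i, by omega, by rw [he]; congr 1; omega⟩)
    · exact Or.inr (Or.inr ⟨c - i, by omega, by rw [he]; congr 1; omega⟩)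
  pi i hi j hj he := by
    have := h.pi _ (by omega) _ (by omega) he
    omega
  qi i hi j hj he := by
    have := h.qi _ (by omega) _ (by omega) he
    omega
  si i hi j hj he := by
    have := h.si _ (by omega) _ (by omega) he
    omega
  pqi i hi j hj he := by
    have := h.pqi _ (by omega) _ (by omega) he
    omega
  psi i hi j hj he := by
    have := h.psi _ (by omega) _ (by omega) he
    omega
  qsi i hi j hj he := by
    have := h.qsi _ (by omega) _ (by omega) he
    omega
  pp i j hij hj := by
    rw [G.dist_comm, h.pp _ _ (by omega) (by omega)]
    omega
  qq i j hij hj := by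
    rw [G.dist_comm, h.qq _ _ (by omega) (by omega)]
    omega
  ss i j hij hj := by
    rw [G.dist_comm, h.ss _ _ (by omega) (by omega)]
    omega
  pq i j hi hj := by
    rw [h.pq _ _ (by omega) (by omega)]
    omega
  ps i j hi hj := by
    rw [h.ps _ _ (by omega) (by omega)]
    omega
  qs i j hi hj := by
    rw [h.qs _ _ (by omega) (by omega)]
    omega

/-- eccentricity bound at the branch vertex -/
theorem Sit.ecc_u {p q s : ℕ → V} {a b c : ℕ} (h : Sit G p q s a b c) (w : V) (hw : w ∈ Core G) :
    G.dist (s 0) w ≤ (a + c) / 2 := by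
  have := h.ab
  have := h.bc
  rcases h.cov w hw with ⟨i, hi, rfl⟩ | ⟨i, hi, rfl⟩ | ⟨i, hi, rfl⟩
  · rw [← h.p0, h.pp 0 i (by omega) hi]
    omega
  · rw [← h.q0, h.qq 0 i (by omega) hi]
    omega
  · rw [h.ss 0 i (by omega) hi]
    omega

theorem Sit.ecc_v {p q s : ℕ → V} {a b c : ℕ} (h : Sit G p q s a b c) (w : V) (hw : w ∈ Core G) :
    G.dist (s c) w ≤ (a + c) / 2 := by
  simpa using h.rev.ecc_u w hw

theorem Ctx.far {x y : V} {r : ℕ} (h : Ctx G x y r) (s t : V) (hst : r < G.dist s t) :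
    (s = x ∧ t = y) ∨ (s = y ∧ t = x) := by
  rcases h.le s t with h1 | h1
  · omega
  · exact h1

theorem Sit.p0_u {p q s : ℕ → V} {a b c : ℕ} (h : Sit G p q s a b c) {x y : V} {r : ℕ}
    (hX : Ctx G x y r) (hall : ∀ w, w ∈ Core G) (h5 : 5 ≤ a + b) (hx : s 0 = x) :
    False := by
  have h1 := h.ab
  have h2 := h.bc
  have hrc := h.ecc_u y (hall y)
  rw [hx, hX.dxy] at hrc
  -- uniqueness of the far vertex from the branch vertex
  have hun : ∀ w, r < G.dist (s 0) w → w = y := by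
    intro w hw
    rcases hX.far _ _ hw with e | e
    · exact e.2
    · exact absurd (hx.symm.trans e.1) hX.ne
  have e1 := h.ss 0 ((a + c) / 2) (by omega) (by omega)
  have hy := hun _ (by rw [e1]; omega)
  have hv : s c = y := by
    by_contra hv
    have e3 := h.ss (c - (a + c) / 2) c (by omega) (by omega)
    have hvx : s c ≠ x := by
      rw [← hx]
      intro he
      have := h.si c le_rfl 0 (by omega) he
      omega
    rcases hX.far (s (c - (a + c) / 2)) (s c) (by rw [e3]; omega) with e | e
    · exact hv e.2
    · exact hvx e.2
  have := h.si _ (by omega) c le_rfl (hy.trans hv.symm)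
  have e4 := h.pq 1 (b - 1) (by omega) (by omega)
  rcases hX.far (p 1) (q (b - 1)) (by rw [e4]; omega) with e | e
  · have := h.psi 1 (by omega) 0 (by omega) (e.1.trans hx.symm)
    omega
  · have := h.psi 1 (by omega) c le_rfl (e.1.trans hv.symm)
    omega

theorem Sit.p0_mid {p q s : ℕ → V} {a b c : ℕ} (h : Sit G p q s a b c) {x y : V} {r : ℕ}
    (hX : Ctx G x y r) (h5 : 5 ≤ a + b) (hodd : (a + b + c) % 2 = 1) (hr : r = (a + c) / 2)
    (i j : ℕ) (hi : i ≤ b) (hj : j ≤ c) (hx : x = q i) (hy : y = s j) : False := by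
  have h1 := h.ab
  have h2 := h.bc
  have hd := hX.dxy
  rw [hx, hy, h.qs i j hi hj] at hd
  have key : ∀ i' j', i' ≤ b → j' ≤ c → G.dist (q i') (s j') = r + 1 → i' = i ∧ j' = j := by
    intro i' j' hi' hj' hdd
    rcases hX.far (q i') (s j') (by omega) with e | e
    · exact ⟨h.qi _ hi' _ hi (e.1.trans hx), h.si _ hj' _ hj (e.2.trans hy)⟩
    · have e1 := h.qsi _ hi' _ hj (e.1.trans hy)
      have e2 := h.qsi _ hi _ hj' (e.2.trans hx).symm
      omega
  have k1 := key (b - i) (c - j) (by omega) (by omega) (by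
    rw [h.qs _ _ (by omega) (by omega)]
    omega)
  have k2 := key (i + 1) (j - 1) (by omega) (by omega) (by
    rw [h.qs _ _ (by omega) (by omega)]
    omega)
  omega

theorem Sit.p0_false {p q s : ℕ → V} {a b c : ℕ} (h : Sit G p q s a b c) {x y : V} {r : ℕ}
    (hX : Ctx G x y r) (hall : ∀ w, w ∈ Core G) (h5 : 5 ≤ a + b) (hodd : (a + b + c) % 2 = 1) :
    False := by
  have h1 := h.ab
  have h2 := h.bc
  by_cases hux : s 0 = x
  · exact h.p0_u hX hall h5 hux
  by_cases huy : s 0 = y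
  · exact h.p0_u hX.symm hall h5 huy
  have hr : r = (a + c) / 2 := by
    obtain ⟨t, ht⟩ := hX.ecc _ hux huy
    have e0 := h.ecc_u t (hall t)
    have e1 := h.ss 0 ((a + c) / 2) (by omega) (by omega)
    by_contra hne
    rcases hX.far (s 0) (s ((a + c) / 2)) (by rw [e1]; omega) with e | e
    · exact hux e.1
    · exact huy e.1
  have hd := hX.dxy
  rcases h.cov x (hall x) with ⟨i, hi, hx⟩ | ⟨i, hi, hx⟩ | ⟨i, hi, hx⟩ <;>
    rcases h.cov y (hall y) with ⟨j, hj, hy⟩ | ⟨j, hj, hy⟩ | ⟨j, hj, hy⟩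
  · rw [hx, hy] at hd
    rcases le_total i j with hij | hij
    · rw [h.pp i j hij hj] at hd
      omega
    · rw [G.dist_comm, h.pp j i hij hi] at hd
      omega
  · rw [hx, hy, h.pq i j hi hj] at hd
    omega
  · rw [hx, hy, h.ps i j hi hj] at hd
    omega
  · rw [hx, hy, G.dist_comm, h.pq j i hj hi] at hd
    omega
  · rw [hx, hy] at hd
    rcases le_total i j with hij | hij
    · rw [h.qq i j hij hj] at hd
      omega
    · rw [G.dist_comm, h.qq j i hij hi] at hd
      omega
  · exact h.p0_mid hX h5 hodd hr i j hi hj hx hy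
  · rw [hx, hy, G.dist_comm, h.ps j i hj hi] at hd
    omega
  · exact h.p0_mid hX.symm h5 hodd hr j i hj hi hy hx
  · rw [hx, hy] at hd
    rcases le_total i j with hij | hij
    · rw [h.ss i j hij hj] at hd
      omega
    · rw [G.dist_comm, h.ss j i hij hi] at hd
      omega

set_option maxHeartbeats 4000000 in
/-- one leaf -/
theorem Sit.p1_false {p q s : ℕ → V} {a b c : ℕ} (h : Sit G p q s a b c) {x y x' : V} {r k : ℕ}
    (hX : Ctx G x y r) (hr2 : 2 ≤ r) (hx : x ∉ Core G) (hxx : G.Adj x x') (hx' : x' ∈ Core G)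
    (hy : y ∈ Core G) (hg : 4 * k + 1 ≤ a + b) (hN : Num (a + b + c) k) : False := by
  have h1 := h.ab
  have h2 := h.bc
  obtain ⟨N1, N2, N3, N4, N5⟩ := hN
  have hleaf : ∀ w ∈ Core G, G.dist x w = G.dist x' w + 1 := fun w hw =>
    leaf_dist hX.conn hx hxx (fun he => hx (he ▸ hw))
  have hcore : ∀ s ∈ Core G, ∀ t ∈ Core G, G.dist s t ≤ r := by
    intro s hs t ht
    by_contra hlt
    rcases hX.far s t (by omega) with e | e
    · exact hx (e.1 ▸ hs)
    · exact hx (e.2 ▸ ht)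
  have hdy : G.dist x' y = r := by
    have := hleaf y hy
    have := hX.dxy
    omega
  have hun : ∀ w ∈ Core G, r ≤ G.dist x' w → w = y := by
    intro w hw hd
    have := hleaf w hw
    rcases hX.far x w (by omega) with e | e
    · exact e.2
    · exact absurd e.1 hX.ne
  have hecc : ∀ w ∈ Core G, w ≠ y → (∃ t ∈ Core G, G.dist w t = r) ∨ G.dist w x' + 1 = r := by
    intro w hw hwy
    obtain ⟨t, ht⟩ := hX.ecc w (fun he => hx (he ▸ hw)) hwy
    by_cases htc : t ∈ Core G
    · exact Or.inl ⟨t, htc, ht⟩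
    · rcases hX.leaf_eq hr2 htc with rfl | rfl
      · right
        rw [G.dist_comm, ← hleaf w hw, G.dist_comm, ht]
      · exact absurd hy htc
  have hre : (a + c) / 2 ≤ r := by
    have e1 := h.ss 0 ((a + c) / 2) (by omega) (by omega)
    have e2 := hcore _ (h.sc 0 (by omega)) _ (h.sc ((a + c) / 2) (by omega))
    omega
  have hu := h.ecc_u
  have hv := h.ecc_v
  have u1 := hu x' hx'
  have v1 := hv x' hx'
  have hr : r = (a + c) / 2 := by
    by_contra hne
    have huy : s 0 ≠ y := by
      intro he
      rw [he, G.dist_comm] at u1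
      omega
    have hvy : s c ≠ y := by
      intro he
      rw [he, G.dist_comm] at v1
      omega
    have u2 : G.dist (s 0) x' = (a + c) / 2 := by
      rcases hecc _ (h.sc 0 (by omega)) huy with ⟨t, t1, t2⟩ | t
      · have := hu t t1
        omega
      · omega
    have v2 : G.dist (s c) x' = (a + c) / 2 := by
      rcases hecc _ (h.sc c le_rfl) hvy with ⟨t, t1, t2⟩ | t
      · have := hv t t1
        omega
      · omega
    rcases h.cov x' hx' with ⟨i, hi, he⟩ | ⟨i, hi, he⟩ | ⟨i, hi, he⟩
    · rw [he, ← h.p0, h.pp 0 i (by omega) hi] at u2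
      rw [he, ← h.p1, G.dist_comm, h.pp i a hi le_rfl] at v2
      omega
    · rw [he, ← h.q0, h.qq 0 i (by omega) hi] at u2
      rw [he, ← h.q1, G.dist_comm, h.qq i b hi le_rfl] at v2
      omega
    · rw [he, h.ss 0 i (by omega) hi] at u2
      rw [he, G.dist_comm, h.ss i c hi le_rfl] at v2
      omega
  have e3 := h.qs (b / 2) ((c + 1) / 2) (by omega) (by omega)
  have e4 := hcore _ (h.qc (b / 2) (by omega)) _ (h.sc ((c + 1) / 2) (by omega))
  rw [e3] at e4
  have e5 : a = 2 * k + 1 ∧ b = 2 * k + 1 ∧ c = 2 * k + 2 := by omega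
  obtain ⟨rfl, rfl, rfl⟩ := e5
  have hr' : r = 2 * k + 1 := by omega
  -- two far vertices
  have two : ∀ i j, i ≤ 2 * k + 2 → j ≤ 2 * k + 2 → G.dist x' (s i) = r → G.dist x' (s j) = r →
      i = j := by
    intro i j hi hj d1 d2
    exact h.si i hi j hj ((hun _ (h.sc i hi) d1.ge).trans (hun _ (h.sc j hj) d2.ge).symm)
  have caseP : ∀ i, i ≤ 2 * k + 1 → x' = p i → False := by
    intro i hi he
    have := two (2 * k + 2 - i) (2 * k + 1 - i) (by omega) (by omega)
      (by rw [he, h.ps _ _ hi (by omega)]; omega) (by rw [he, h.ps _ _ hi (by omega)]; omega)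
    omega
  rcases h.cov x' hx' with ⟨i, hi, he⟩ | ⟨i, hi, he⟩ | ⟨i, hi, he⟩
  · exact caseP i hi he
  · have := two (2 * k + 2 - i) (2 * k + 1 - i) (by omega) (by omega)
      (by rw [he, h.qs _ _ hi (by omega)]; omega) (by rw [he, h.qs _ _ hi (by omega)]; omega)
    omega
  · by_cases hi0 : i = 0
    · exact caseP 0 (by omega) (by rw [he, hi0, h.p0])
    by_cases hi1 : i = 2 * k + 2
    · exact caseP (2 * k + 1) le_rfl (by rw [he, hi1, h.p1])
    have d1 : G.dist x' (p (2 * k + 1 - i)) = r := by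
      rw [he, G.dist_comm, h.ps _ _ (by omega) hi]
      omega
    have d2 : G.dist x' (p (2 * k + 2 - i)) = r := by
      rw [he, G.dist_comm, h.ps _ _ (by omega) hi]
      omega
    have := h.pi _ (by omega) _ (by omega) ((hun _ (h.pc _ (by omega)) d1.ge).trans
      (hun _ (h.pc _ (by omega)) d2.ge).symm)
    omega

set_option maxHeartbeats 4000000 in
/-- two leaves -/
theorem Sit.p2_false {p q s : ℕ → V} {a b c : ℕ} (h : Sit G p q s a b c) {x y x' y' : V} {r k : ℕ}
    (hX : Ctx G x y r) (hr2 : 2 ≤ r) (hx : x ∉ Core G) (hxx : G.Adj x x') (hx' : x' ∈ Core G)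
    (hy : y ∉ Core G) (hyy : G.Adj y y') (hy' : y' ∈ Core G)
    (hg : 4 * k + 1 ≤ a + b) (hN : Num (a + b + c + 1) k) : False := by
  have h1 := h.ab
  have h2 := h.bc
  obtain ⟨N1, N2, N3, N4, N5⟩ := hN
  have hleafx : ∀ w, w ≠ x → G.dist x w = G.dist x' w + 1 := fun w hw =>
    leaf_dist hX.conn hx hxx hw.symm
  have hleafy : ∀ w, w ≠ y → G.dist y w = G.dist y' w + 1 := fun w hw =>
    leaf_dist hX.conn hy hyy hw.symm
  have hcx : ∀ w ∈ Core G, w ≠ x := fun w hw he => hx (he ▸ hw)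
  have hcy : ∀ w ∈ Core G, w ≠ y := fun w hw he => hy (he ▸ hw)
  have hcore : ∀ s ∈ Core G, ∀ t ∈ Core G, G.dist s t ≤ r := by
    intro s hs t ht
    by_contra hlt
    rcases hX.far s t (by omega) with e | e
    · exact hx (e.1 ▸ hs)
    · exact hx (e.2 ▸ ht)
  have hxy' : G.dist x' y' + 1 = r := by
    have e1 := hleafx y hX.ne.symm
    have e2 := hleafy x' (hcy x' hx')
    rw [hX.dxy] at e1
    rw [G.dist_comm, G.dist_comm (u := y')] at e2
    omega
  have hxr : ∀ w ∈ Core G, G.dist x' w + 1 ≤ r := by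
    intro w hw
    have := hleafx w (hcx w hw)
    by_contra hlt
    rcases hX.far x w (by omega) with e | e
    · exact hcy w hw e.2
    · exact hX.ne e.1
  have hecc : ∀ w ∈ Core G, (∃ t ∈ Core G, G.dist w t = r) ∨ G.dist w x' + 1 = r ∨
      G.dist w y' + 1 = r := by
    intro w hw
    obtain ⟨t, ht⟩ := hX.ecc w (hcx w hw) (hcy w hw)
    by_cases htc : t ∈ Core G
    · exact Or.inl ⟨t, htc, ht⟩
    · rcases hX.leaf_eq hr2 htc with rfl | rfl
      · right; left
        rw [G.dist_comm, ← hleafx w (hcx w hw), G.dist_comm, ht]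
      · right; right
        rw [G.dist_comm, ← hleafy w (hcy w hw), G.dist_comm, ht]
  have hu := h.ecc_u
  have hv := h.ecc_v
  have hre : r ≤ (a + c) / 2 + 1 := by
    rcases hecc _ (h.sc 0 (by omega)) with ⟨t, t1, t2⟩ | t | t
    · have := hu t t1
      omega
    · have := hu x' hx'
      omega
    · have := hu y' hy'
      omega
  have e3 := h.qs (b / 2) ((c + 1) / 2) (by omega) (by omega)
  have e4 := hcore _ (h.qc (b / 2) (by omega)) _ (h.sc ((c + 1) / 2) (by omega))
  rw [e3] at e4
  have fam : (a = 2 * k ∧ b = 2 * k + 1 ∧ c = 2 * k + 2) ∨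
      (a = 2 * k + 1 ∧ b = 2 * k + 1 ∧ c = 2 * k + 1) := by omega
  have hr : r = 2 * k + 2 := by
    have : 2 * k + 1 < r := by
      by_contra hlt
      rcases h.cov x' hx' with ⟨i, hi, he⟩ | ⟨i, hi, he⟩ | ⟨i, hi, he⟩
      · have e1 := hxr _ (h.sc (2 * k + 1 - i) (by omega))
        rw [he, h.ps _ _ hi (by omega)] at e1
        omega
      · by_cases hib : i = b
        · have e1 := hxr _ (h.sc (2 * k + 1 - a) (by omega))
          rw [he, hib, h.q1, ← h.p1, h.ps _ _ le_rfl (by omega)] at e1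
          omega
        · have e1 := hxr _ (h.sc (2 * k + 1 - i) (by omega))
          rw [he, h.qs _ _ hi (by omega)] at e1
          omega
      · by_cases hic : i ≤ 2 * k + 1
        · by_cases hia : 2 * k + 1 - i ≤ a
          · have e1 := hxr _ (h.pc (2 * k + 1 - i) (by omega))
            rw [he, G.dist_comm, h.ps _ _ (by omega) (by omega)] at e1
            omega
          · have e1 := hxr _ (h.sc (2 * k + 1) (by omega))
            rw [he, h.ss i _ (by omega) (by omega)] at e1
            omega
        · have e1 := hxr _ (h.sc 1 (by omega))
          rw [he, G.dist_comm, h.ss 1 i (by omega) hi] at e1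
          omega
    omega
  have hu' : G.dist (s 0) x' = 2 * k + 1 ∨ G.dist (s 0) y' = 2 * k + 1 := by
    rcases hecc _ (h.sc 0 (by omega)) with ⟨t, t1, t2⟩ | t | t
    · have := hu t t1
      omega
    · omega
    · omega
  have hv' : G.dist (s c) x' = 2 * k + 1 ∨ G.dist (s c) y' = 2 * k + 1 := by
    rcases hecc _ (h.sc c le_rfl) with ⟨t, t1, t2⟩ | t | t
    · have := hv t t1
      omega
    · omega
    · omega
  have hu2 : ∀ w ∈ Core G, G.dist (s 0) w = 2 * k + 1 → w = s (2 * k + 1) := by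
    intro w hw hd
    rcases h.cov w hw with ⟨i, hi, he⟩ | ⟨i, hi, he⟩ | ⟨i, hi, he⟩
    · rw [he, ← h.p0, h.pp 0 i (by omega) hi] at hd
      have e1 : i = a := by omega
      have e2 : c = 2 * k + 1 := by omega
      rw [he, e1, h.p1, e2]
    · rw [he, ← h.q0, h.qq 0 i (by omega) hi] at hd
      have e1 : i = b := by omega
      have e2 : c = 2 * k + 1 := by omega
      rw [he, e1, h.q1, e2]
    · rw [he, h.ss 0 i (by omega) hi] at hd
      have e1 : i = 2 * k + 1 := by omega
      rw [he, e1]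
  have hv2 : ∀ w ∈ Core G, G.dist (s c) w = 2 * k + 1 → w = s (c - (2 * k + 1)) := by
    intro w hw hd
    rw [G.dist_comm] at hd
    rcases h.cov w hw with ⟨i, hi, he⟩ | ⟨i, hi, he⟩ | ⟨i, hi, he⟩
    · rw [he, ← h.p1, h.pp i a hi le_rfl] at hd
      have e1 : i = 0 := by omega
      have e2 : c = 2 * k + 1 := by omega
      rw [he, e1, h.p0, e2, Nat.sub_self]
    · rw [he, ← h.q1, h.qq i b hi le_rfl] at hd
      have e1 : i = 0 := by omega
      have e2 : c = 2 * k + 1 := by omega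
      rw [he, e1, h.q0, e2, Nat.sub_self]
    · rw [he, h.ss i c hi le_rfl] at hd
      have e1 : i = c - (2 * k + 1) := by omega
      rw [he, e1]
  have hd := h.ss (c - (2 * k + 1)) (2 * k + 1) (by omega) (by omega)
  have hd' := G.dist_comm (u := s (c - (2 * k + 1))) (v := s (2 * k + 1))
  have h00 := G.dist_self (v := s (2 * k + 1))
  have h01 := G.dist_self (v := s (c - (2 * k + 1)))
  have w1 := hecc (p 1) (h.pc 1 (by omega))
  have hpx : ∀ t ∈ Core G, G.dist (p 1) t ≤ 2 * k + 1 := by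
    intro t ht
    rcases h.cov t ht with ⟨i, hi, he⟩ | ⟨i, hi, he⟩ | ⟨i, hi, he⟩
    · rcases le_total 1 i with hij | hij
      · rw [he, h.pp 1 i hij hi]
        omega
      · rw [he, G.dist_comm, h.pp i 1 hij (by omega)]
        omega
    · rw [he, h.pq 1 i (by omega) hi]
      omega
    · rw [he, h.ps 1 i (by omega) hi]
      omega
  have w2 : G.dist (p 1) x' = 2 * k + 1 ∨ G.dist (p 1) y' = 2 * k + 1 := by
    rcases w1 with ⟨t, t1, t2⟩ | t | t
    · have := hpx t t1
      omega
    · omega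
    · omega
  have f1 := h.ps 1 (2 * k + 1) (by omega) (by omega)
  have f2 := h.ps 1 (c - (2 * k + 1)) (by omega) (by omega)
  rcases hu' with e | e <;> rcases hv' with e' | e'
  · have g1 := hu2 _ hx' e
    have g2 := hv2 _ hx' e'
    rw [← g1, ← g2] at hd
    simp at hd
    omega
  · have g1 := hu2 _ hx' e
    have g2 := hv2 _ hy' e'
    rw [g1, g2] at w2 hxy'
    omega
  · have g1 := hu2 _ hy' e
    have g2 := hv2 _ hx' e'
    rw [g1, g2] at w2 hxy'
    omega
  · have g1 := hu2 _ hy' e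
    have g2 := hv2 _ hy' e'
    rw [← g1, ← g2] at hd
    simp at hd
    omega

theorem main_aux [Fintype V] {k : ℕ} (hg : GirthGE G (4 * k + 1)) (hN : Num (Fintype.card V) k)
    {x y : V} {r : ℕ} (hX : Ctx G x y r) : False := by
  classical
  have hN' := hN
  obtain ⟨N1, N2, N3, N4, N5⟩ := hN'
  have h6 : 6 ≤ Fintype.card V := by omega
  have hr := hX.two_le hg (by omega) h6
  obtain ⟨p, q, s, a, b, c, h, hab, K, hK, hKc⟩ := exists_sit hg hN hX hr
  have hnt : Nontrivial V := ⟨x, y, hX.ne⟩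
  obtain ⟨x', hxx⟩ := hX.conn.preconnected.exists_adj_of_nontrivial x
  obtain ⟨y', hyy⟩ := hX.conn.preconnected.exists_adj_of_nontrivial y
  by_cases hx : x ∈ Core G
  · by_cases hy : y ∈ Core G
    · have hall : ∀ w, w ∈ Core G := by
        intro w
        by_contra hw
        rcases hX.leaf_eq hr hw with rfl | rfl
        · exact hw hx
        · exact hw hy
      have : K = Finset.univ := Finset.eq_univ_iff_forall.2 fun w => (hK w).2 (hall w)
      rw [this, Finset.card_univ] at hKc
      exact h.p0_false hX hall (by omega) (by omega)
    · have : insert y K = Finset.univ := by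
        refine Finset.eq_univ_iff_forall.2 fun w => ?_
        rw [Finset.mem_insert, hK]
        by_contra hw
        push Not at hw
        rcases hX.leaf_eq hr hw.2 with rfl | rfl
        · exact hw.2 hx
        · exact hw.1 rfl
      have e := Finset.card_insert_of_notMem (a := y) (s := K) (by rw [hK]; exact hy)
      rw [this, Finset.card_univ] at e
      exact h.p1_false hX.symm hr hy hyy (leaf_nbr hX.conn h6 hy hyy) hx hab
        (by rw [← hKc, ← e]; exact hN)
  · by_cases hy : y ∈ Core G
    · have : insert x K = Finset.univ := by
        refine Finset.eq_univ_iff_forall.2 fun w => ?_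
        rw [Finset.mem_insert, hK]
        by_contra hw
        push Not at hw
        rcases hX.leaf_eq hr hw.2 with rfl | rfl
        · exact hw.1 rfl
        · exact hw.2 hy
      have e := Finset.card_insert_of_notMem (a := x) (s := K) (by rw [hK]; exact hx)
      rw [this, Finset.card_univ] at e
      exact h.p1_false hX hr hx hxx (leaf_nbr hX.conn h6 hx hxx) hy hab
        (by rw [← hKc, ← e]; exact hN)
    · have : insert x (insert y K) = Finset.univ := by
        refine Finset.eq_univ_iff_forall.2 fun w => ?_
        rw [Finset.mem_insert, Finset.mem_insert, hK]
        by_contra hw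
        push Not at hw
        rcases hX.leaf_eq hr hw.2.2 with rfl | rfl
        · exact hw.1 rfl
        · exact hw.2.1 rfl
      have e := Finset.card_insert_of_notMem (a := y) (s := K) (by rw [hK]; exact hy)
      have e' := Finset.card_insert_of_notMem (a := x) (s := insert y K) (by
        rw [Finset.mem_insert, hK]
        rintro (h | h)
        · exact hX.ne h
        · exact hx h)
      rw [this, Finset.card_univ, e] at e'
      exact h.p2_false hX hr hx hxx (leaf_nbr hX.conn h6 hx hxx) hy hyy (leaf_nbr hX.conn h6 hy hyy)
        hab (by rw [← hKc, ← e']; exact hN)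

end ASC


theorem girth_le_of_almostSelfCentered_even {V : Type*} [Fintype V]
    (G : SimpleGraph V) (n : ℕ) (hn : Fintype.card V = n)
    (h6 : 6 ≤ n) (hev : Even n) (h10 : n ≠ 10) (hASC : IsAlmostSelfCentered G) :
    G.egirth ≤ ((4 * (n / 6) : ℕ) : ℕ∞) := by
  by_contra hcon
  have hg := ASC.girthGE_of_not (4 * (n / 6)) hcon
  subst hn
  obtain ⟨x, y, r, hX⟩ := ASC.exists_ctx h6 hASC
  have he := Nat.even_iff.1 hev
  exact ASC.main_aux hg ⟨he, by omega, by omega, by omega, h10⟩ hX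
end

section
/- For every even integer n ≥ 6 there exists an almost self-centered graph of order n with girth exactly 4⌊n/6⌋; such a graph is obtained from the theta graph θ_{2k,2k,n−4k}, where k = ⌊n/6⌋, by attaching a pendant edge to one of its two vertices of degree three. -/
open SimpleGraph

/-- The theta graph `θ_{a,b,c}` (for `a, b, c ≥ 2`): three internally vertex-disjoint paths
of lengths `a`, `b`, `c` sharing the same two endpoints. The two endpoints are the two
vertices of `Fin 2`; the internal vertices of the three paths are the elements of
`Fin (a-1)`, `Fin (b-1)` and `Fin (c-1)` respectively. -/
def thetaGraph (a b c : ℕ) : SimpleGraph (Fin 2 ⊕ (Fin (a - 1) ⊕ Fin (b - 1) ⊕ Fin (c - 1))) :=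
  SimpleGraph.fromRel fun u v =>
    match u, v with
    | Sum.inl i, Sum.inr (Sum.inl p) =>
        ((i : ℕ) = 0 ∧ (p : ℕ) = 0) ∨ ((i : ℕ) = 1 ∧ (p : ℕ) = a - 2)
    | Sum.inl i, Sum.inr (Sum.inr (Sum.inl p)) =>
        ((i : ℕ) = 0 ∧ (p : ℕ) = 0) ∨ ((i : ℕ) = 1 ∧ (p : ℕ) = b - 2)
    | Sum.inl i, Sum.inr (Sum.inr (Sum.inr p)) =>
        ((i : ℕ) = 0 ∧ (p : ℕ) = 0) ∨ ((i : ℕ) = 1 ∧ (p : ℕ) = c - 2)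
    | Sum.inr (Sum.inl p), Sum.inr (Sum.inl q) => (q : ℕ) = (p : ℕ) + 1
    | Sum.inr (Sum.inr (Sum.inl p)), Sum.inr (Sum.inr (Sum.inl q)) => (q : ℕ) = (p : ℕ) + 1
    | Sum.inr (Sum.inr (Sum.inr p)), Sum.inr (Sum.inr (Sum.inr q)) => (q : ℕ) = (p : ℕ) + 1
    | _, _ => False

/-- The graph obtained from the theta graph `θ_{a,b,c}` by attaching a pendant edge to
one of its two vertices of degree three (namely the endpoint `0`). -/
def thetaPlusPendant (a b c : ℕ) :
    SimpleGraph ((Fin 2 ⊕ (Fin (a - 1) ⊕ Fin (b - 1) ⊕ Fin (c - 1))) ⊕ Unit) :=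
  SimpleGraph.fromRel fun u v =>
    match u, v with
    | Sum.inl x, Sum.inl y => (thetaGraph a b c).Adj x y
    | Sum.inl (Sum.inl i), Sum.inr _ => (i : ℕ) = 0
    | _, _ => False

/-- Abstract description of a theta graph with a pendant vertex `z` attached at one end:
`x i p` is the vertex at position `p` on the `i`-th path, whose length is `L i`. -/
structure ThetaLike {V : Type*} (G : SimpleGraph V) (x : Fin 3 → ℕ → V) (z : V)
    (L : Fin 3 → ℕ) : Prop where
  pos : ∀ i, 2 ≤ L i
  e0 : ∀ i j, x i 0 = x j 0
  e1 : ∀ i j, x i (L i) = x j (L j)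
  inj : ∀ i j p q, p ≤ L i → q ≤ L j → x i p = x j q →
    (i = j ∧ p = q) ∨ (p = 0 ∧ q = 0) ∨ (p = L i ∧ q = L j)
  nz : ∀ i p, x i p ≠ z
  surj : ∀ v, v = z ∨ ∃ i p, p ≤ L i ∧ x i p = v
  adj : ∀ i p, p < L i → G.Adj (x i p) (x i (p + 1))
  adjz : G.Adj (x 0 0) z
  inv : ∀ u v, G.Adj u v →
    (∃ i p, p < L i ∧ ((u = x i p ∧ v = x i (p + 1)) ∨ (v = x i p ∧ u = x i (p + 1)))) ∨
      (u = x 0 0 ∧ v = z) ∨ (v = x 0 0 ∧ u = z)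

namespace ThetaLike

variable {V : Type*} {G : SimpleGraph V} {x : Fin 3 → ℕ → V} {z : V} {L : Fin 3 → ℕ}

/-- A compatible family of functions on the three paths extends to the vertex set. -/
lemma extend (h : ThetaLike G x z L) (g : Fin 3 → ℕ → ℤ) (t : ℤ)
    (g0 : ∀ i j, g i 0 = g j 0) (g1 : ∀ i j, g i (L i) = g j (L j)) :
    ∃ f : V → ℤ, f z = t ∧ ∀ i p, p ≤ L i → f (x i p) = g i p := by
  classical
  have key : ∀ v, ∃ y : ℤ, (v = z → y = t) ∧ ∀ i p, p ≤ L i → x i p = v → y = g i p := by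
    intro v
    rcases h.surj v with rfl | ⟨i, p, hp, rfl⟩
    · exact ⟨t, fun _ => rfl, fun i p _ e => absurd e (h.nz i p)⟩
    · refine ⟨g i p, fun e => absurd e (h.nz i p), ?_⟩
      intro j q hq e
      rcases h.inj _ _ _ _ hq hp e with ⟨rfl, rfl⟩ | ⟨rfl, rfl⟩ | ⟨rfl, rfl⟩
      · rfl
      · exact g0 _ _
      · exact g1 _ _
  choose f hf1 hf2 using key
  exact ⟨f, hf1 z rfl, fun i p hp => hf2 _ i p hp rfl⟩

lemma walk_lip {f : V → ℤ} (hf : ∀ u v, G.Adj u v → f v - f u ≤ 1) {u v : V}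
    (w : G.Walk u v) : f v - f u ≤ w.length := by
  induction w with
  | nil => simp
  | cons hadj w ih =>
    have := hf _ _ hadj
    rw [Walk.length_cons]; push_cast; linarith

lemma path_dist (h : ThetaLike G x z L) (i : Fin 3) (p d : ℕ) (hd : p + d ≤ L i) :
    ∃ w : G.Walk (x i p) (x i (p + d)), w.length = d := by
  induction d with
  | zero => exact ⟨Walk.nil, rfl⟩
  | succ d ih =>
    obtain ⟨w, hw⟩ := ih (by omega)
    exact ⟨w.concat (h.adj i (p + d) (by omega)), by simp [hw]⟩

lemma connected (h : ThetaLike G x z L) : G.Connected := by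
  have key : ∀ v, G.Reachable (x 0 0) v := by
    intro v
    rcases h.surj v with rfl | ⟨i, p, hp, rfl⟩
    · exact h.adjz.reachable
    · obtain ⟨w, -⟩ := h.path_dist i 0 p (by omega)
      rw [h.e0 0 i]
      simpa using w.reachable
  have : Nonempty V := ⟨z⟩
  exact ⟨fun u v => (key u).symm.trans (key v)⟩

lemma lower (h : ThetaLike G x z L) (g : Fin 3 → ℕ → ℤ) (t : ℤ)
    (g0 : ∀ i j, g i 0 = g j 0) (g1 : ∀ i j, g i (L i) = g j (L j))
    (gs : ∀ i p, p < L i → |g i (p + 1) - g i p| ≤ 1) (gt : |g 0 0 - t| ≤ 1) :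
    (∀ i j p q, p ≤ L i → q ≤ L j → g j q - g i p ≤ G.dist (x i p) (x j q)) ∧
    (∀ j q, q ≤ L j → g j q - t ≤ G.dist z (x j q)) := by
  obtain ⟨f, fz, fx⟩ := h.extend g t g0 g1
  have hf : ∀ u v, G.Adj u v → f v - f u ≤ 1 := by
    intro u v huv
    have := abs_le.1 gt
    rcases h.inv u v huv with ⟨i, p, hp, ⟨rfl, rfl⟩ | ⟨rfl, rfl⟩⟩ | ⟨rfl, rfl⟩ | ⟨rfl, rfl⟩
    · have := abs_le.1 (gs i p hp)
      rw [fx _ _ hp.le, fx _ _ hp]; linarith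
    · have := abs_le.1 (gs i p hp)
      rw [fx _ _ hp.le, fx _ _ hp]; linarith
    · rw [fz, fx _ _ (Nat.zero_le _)]; linarith
    · rw [fz, fx _ _ (Nat.zero_le _)]; linarith
  have hd : ∀ u v, f v - f u ≤ G.dist u v := by
    intro u v
    obtain ⟨w, hw⟩ := h.connected.exists_walk_length_eq_dist u v
    rw [← hw]; exact walk_lip hf w
  refine ⟨fun i j p q hp hq => ?_, fun j q hq => ?_⟩
  · rw [← fx _ _ hp, ← fx _ _ hq]; exact hd _ _
  · rw [← fz, ← fx _ _ hq]; exact hd _ _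

lemma dist_le_sub (h : ThetaLike G x z L) (i : Fin 3) (p q : ℕ) (hpq : p ≤ q) (hq : q ≤ L i) :
    G.dist (x i p) (x i q) ≤ q - p := by
  obtain ⟨d, rfl⟩ := Nat.exists_eq_add_of_le hpq
  obtain ⟨w, hw⟩ := h.path_dist i p d hq
  have := G.dist_le w
  omega

/-- going around through the endpoint `0` -/
lemma dist_le_add (h : ThetaLike G x z L) (i j : Fin 3) (p q : ℕ) (hp : p ≤ L i) (hq : q ≤ L j) :
    G.dist (x i p) (x j q) ≤ p + q := by
  have h1 := h.dist_le_sub i 0 p (by omega) hp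
  have h2 := h.dist_le_sub j 0 q (by omega) hq
  have h3 := h.connected.dist_triangle (u := x i p) (v := x i 0) (w := x j q)
  rw [G.dist_comm, h.e0 i j] at h3
  rw [G.dist_comm, h.e0 i j] at h1
  rw [G.dist_comm (u := x i p) (v := x j 0)] at h1
  rw [G.dist_comm] at h3
  rw [G.dist_comm (u := x i p) (v := x j 0)] at h3
  omega

/-- going around through the endpoint `1` -/
lemma dist_le_add' (h : ThetaLike G x z L) (i j : Fin 3) (p q : ℕ) (hp : p ≤ L i) (hq : q ≤ L j) :
    G.dist (x i p) (x j q) ≤ (L i - p) + (L j - q) := by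
  have h1 := h.dist_le_sub i p (L i) hp le_rfl
  have h2 := h.dist_le_sub j q (L j) hq le_rfl
  have h3 := h.connected.dist_triangle (u := x i p) (v := x i (L i)) (w := x j q)
  rw [G.dist_comm, ← h.e1 i j] at h2
  omega

lemma dist_z (h : ThetaLike G x z L) (i : Fin 3) (v : V) :
    G.dist z v ≤ 1 + G.dist (x i 0) v := by
  have h3 := h.connected.dist_triangle (u := z) (v := x 0 0) (w := v)
  have : G.dist z (x 0 0) = 1 := dist_eq_one_iff_adj.2 h.adjz.symm
  rw [h.e0 i 0]; omega

/-- the distance bound inside the theta graph -/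
lemma dist_le_R (h : ThetaLike G x z L) {k r : ℕ}
    (l0 : L 0 = 2 * k) (l1 : L 1 = 2 * k) (l2 : L 2 = 2 * k + 2 * r)
    (i j : Fin 3) (p q : ℕ) (hp : p ≤ L i) (hq : q ≤ L j) :
    G.dist (x i p) (x j q) ≤ 2 * k + r := by
  have key : ∀ i p q, p ≤ q → q ≤ L i → G.dist (x i p) (x i q) ≤ 2 * k + r := by
    intro i p q hpq hq
    have h1 := h.dist_le_sub i p q hpq hq
    have h2 := h.dist_le_sub i 0 p (by omega) (by omega)
    have h3 := h.dist_le_add' 0 i 0 q (by omega) hq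
    have h4 := h.connected.dist_triangle (u := x i p) (v := x i 0) (w := x i q)
    rw [h.e0 0 i] at h3
    rw [G.dist_comm (u := x i p) (v := x i 0)] at h4
    fin_cases i <;> simp_all <;> omega
  by_cases hij : i = j
  · subst hij
    rcases le_total p q with hpq | hpq
    · exact key i p q hpq hq
    · rw [G.dist_comm]; exact key i q p hpq hp
  · have h1 := h.dist_le_add i j p q hp hq
    have h2 := h.dist_le_add' i j p q hp hq
    fin_cases i <;> fin_cases j <;> simp_all <;> omega

/-- distances from the pendant vertex -/
lemma dist_z_le (h : ThetaLike G x z L) {k r : ℕ}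
    (l0 : L 0 = 2 * k) (l1 : L 1 = 2 * k) (l2 : L 2 = 2 * k + 2 * r)
    (j : Fin 3) (q : ℕ) (hq : q ≤ L j) (hne : x j q ≠ x 2 (2 * k + r)) :
    G.dist z (x j q) ≤ 2 * k + r := by
  have h0 := h.dist_z j (x j q)
  have h1 := h.dist_le_sub j 0 q (by omega) hq
  have h2 := h.dist_le_add' 0 j 0 q (by omega) hq
  rw [h.e0 0 j] at h2
  by_contra hcon
  have hj : (j = 2 ∧ q = 2 * k + r) ∨ (r = 0 ∧ q = L j) := by
    fin_cases j <;> simp_all <;> omega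
  rcases hj with ⟨rfl, rfl⟩ | ⟨rfl, rfl⟩
  · exact hne rfl
  · apply hne
    rw [h.e1 j 2, l2]

/-- position on the folded cycle of length `4k+2r` -/
def phi (k r : ℕ) (i : Fin 3) (p : ℕ) : ℤ := if i = 2 then p else 4 * k + 2 * r - p

/-- distance on the cycle -/
def cd (N s y : ℤ) : ℤ := min |s - y| (N - |s - y|)

lemma lower_phi (h : ThetaLike G x z L) {k r : ℕ}
    (l0 : L 0 = 2 * k) (l1 : L 1 = 2 * k) (l2 : L 2 = 2 * k + 2 * r) (hk : 0 < k)
    (s : ℤ) (hs : 0 ≤ s) (hs' : s ≤ 4 * k + 2 * r) (t : ℤ)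
    (ht : |cd (4 * k + 2 * r) s 0 - t| ≤ 1) :
    (∀ i j p q, p ≤ L i → q ≤ L j →
      cd (4 * k + 2 * r) s (phi k r j q) - cd (4 * k + 2 * r) s (phi k r i p)
        ≤ G.dist (x i p) (x j q)) ∧
    (∀ j q, q ≤ L j → cd (4 * k + 2 * r) s (phi k r j q) - t ≤ G.dist z (x j q)) := by
  have hz : ∀ i, cd (4 * k + 2 * r) s (phi k r i 0) = cd (4 * k + 2 * r) s 0 := by
    intro i
    unfold cd phi
    split_ifs
    · simp
    · push_cast; grind
  have hL : ∀ i, phi k r i (L i) = 2 * k + 2 * r := by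
    intro i
    unfold phi
    fin_cases i <;> simp [l0, l1, l2]; ring
    ring
  apply h.lower (fun i p => cd (4 * k + 2 * r) s (phi k r i p)) t
  · intro i j
    simp only [hz]
  · intro i j
    simp only [hL]
  · intro i p hp
    have : p < 4 * k + 2 * r := by fin_cases i <;> simp_all <;> omega
    unfold cd phi
    split_ifs
    · push_cast; grind
    · push_cast; grind
  · simp only [hz]; exact ht

lemma exists_phi {k r : ℕ} (l0 : L 0 = 2 * k) (l2 : L 2 = 2 * k + 2 * r)
    (y : ℤ) (hy : 0 ≤ y) (hy' : y ≤ 4 * k + 2 * r) :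
    ∃ j q, q ≤ L j ∧ phi k r j q = y := by
  by_cases hc : y ≤ 2 * k + 2 * r
  · exact ⟨2, y.toNat, by omega, by simp [phi, hy]⟩
  · refine ⟨0, (4 * k + 2 * r - y).toNat, by omega, ?_⟩
    simp [phi]; omega

lemma exists_far (h : ThetaLike G x z L) {k r : ℕ}
    (l0 : L 0 = 2 * k) (l1 : L 1 = 2 * k) (l2 : L 2 = 2 * k + 2 * r) (hk : 0 < k)
    (i : Fin 3) (p : ℕ) (hp : p ≤ L i) :
    ∃ v, 2 * k + r ≤ G.dist (x i p) v := by
  have hb : 0 ≤ phi k r i p ∧ phi k r i p ≤ 4 * k + 2 * r := by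
    unfold phi
    fin_cases i <;> simp_all <;> omega
  obtain ⟨hs, hs'⟩ := hb
  have hl := (h.lower_phi l0 l1 l2 hk (phi k r i p) hs hs' _ (by rw [sub_self]; simp)).1
  have : ∃ y : ℤ, 0 ≤ y ∧ y ≤ 4 * k + 2 * r ∧ |phi k r i p - y| = 2 * k + r := by
    by_cases hc : phi k r i p ≤ 2 * k + r
    · exact ⟨phi k r i p + (2 * k + r), by omega, by omega, by grind⟩
    · exact ⟨phi k r i p - (2 * k + r), by omega, by omega, by grind⟩
  obtain ⟨y, hy, hy', hyd⟩ := this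
  obtain ⟨j, q, hq, rfl⟩ := exists_phi l0 l2 y hy hy'
  refine ⟨x j q, ?_⟩
  have := hl i j p q hp hq
  unfold cd at this
  rw [hyd] at this
  have e : min (2 * (k : ℤ) + r) (4 * k + 2 * r - (2 * k + r)) = 2 * k + r := by
    rw [min_eq_left]; linarith
  rw [e] at this
  have e' : min |phi k r i p - phi k r i p| (4 * k + 2 * r - |phi k r i p - phi k r i p|) = 0 := by
    rw [sub_self, abs_zero, sub_zero, min_eq_left]; positivity
  rw [e'] at this
  omega

lemma far_z (h : ThetaLike G x z L) {k r : ℕ}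
    (l0 : L 0 = 2 * k) (l1 : L 1 = 2 * k) (l2 : L 2 = 2 * k + 2 * r) (hk : 0 < k) :
    2 * k + r + 1 ≤ G.dist z (x 2 (2 * k + r)) := by
  have e0 : cd (4 * k + 2 * r) 0 0 = 0 := by
    unfold cd
    rw [sub_self, abs_zero, sub_zero, min_eq_left]; positivity
  have hl := (h.lower_phi l0 l1 l2 hk 0 le_rfl (by positivity) (-1)
    (by rw [e0]; simp)).2 2 (2 * k + r) (by omega)
  have e1 : cd (4 * k + 2 * r) 0 (phi k r 2 (2 * k + r)) = 2 * k + r := by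
    unfold cd phi
    simp only [if_true]
    push_cast
    grind
  rw [e1] at hl
  omega

lemma almostSelfCentered [Fintype V] (h : ThetaLike G x z L) {k r : ℕ}
    (l0 : L 0 = 2 * k) (l1 : L 1 = 2 * k) (l2 : L 2 = 2 * k + 2 * r) (hk : 0 < k) :
    IsAlmostSelfCentered G := by
  classical
  refine ⟨h.connected, ?_⟩
  set R := 2 * k + r with hR
  set w := x 2 R with hw
  have hwz : w ≠ z := h.nz _ _
  have hle : ∀ u v, G.dist u v ≤ graphEcc G u := fun u v =>
    Finset.le_sup (f := fun v => G.dist u v) (Finset.mem_univ v)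
  have h1 : R + 1 ≤ graphEcc G z := (h.far_z l0 l1 l2 hk).trans (hle _ _)
  have h2 : R + 1 ≤ graphEcc G w := by
    refine le_trans ?_ (hle w z)
    rw [G.dist_comm]; exact h.far_z l0 l1 l2 hk
  have h3 : ∀ v, v ≠ z → v ≠ w → graphEcc G v = R := by
    intro v hvz hvw
    rcases h.surj v with rfl | ⟨i, p, hp, rfl⟩
    · exact absurd rfl hvz
    · apply le_antisymm
      · apply Finset.sup_le
        intro u _
        rcases h.surj u with rfl | ⟨j, q, hq, rfl⟩
        · rw [G.dist_comm]
          exact h.dist_z_le l0 l1 l2 i p hp hvw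
        · exact h.dist_le_R l0 l1 l2 i j p q hp hq
      · obtain ⟨u, hu⟩ := h.exists_far l0 l1 l2 hk i p hp
        exact hu.trans (hle _ _)
  have hlow : ∀ v, R ≤ graphEcc G v := by
    intro v
    by_cases hvz : v = z
    · subst hvz; omega
    · by_cases hvw : v = w
      · rw [hvw]; omega
      · exact (h3 v hvz hvw).ge
  have hrad : graphRadius G = R := by
    have h00 : x 0 0 ≠ w := by
      intro e
      have := h.pos 2
      rcases h.inj _ _ _ _ (Nat.zero_le _) (by omega) e with h' | h' | h'
      · exact absurd h'.1 (by decide)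
      · omega
      · have := h.pos 0
        omega
    apply le_antisymm
    · exact Nat.sInf_le ⟨x 0 0, h3 _ (h.nz _ _) h00⟩
    · apply le_csInf (s := Set.range (graphEcc G)) ⟨graphEcc G z, z, rfl⟩
      rintro _ ⟨v, rfl⟩
      exact hlow v
  have hset : {v : V | graphEcc G v = graphRadius G} = ↑(({z, w} : Finset V)ᶜ) := by
    ext v
    simp only [Set.mem_ofPred_eq, Finset.coe_compl, Set.mem_compl_iff, Finset.mem_coe,
      Finset.mem_insert, Finset.mem_singleton, hrad]
    constructor
    · rintro hv (rfl | rfl) <;> omega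
    · intro hv
      push Not at hv
      exact h3 v hv.1 hv.2
  rw [hset]
  simp only [Finset.coe_sort_coe, Nat.card_eq_fintype_card, Fintype.card_coe]
  rw [Finset.card_compl, Finset.card_pair hwz.symm]

lemma nbr_int (h : ThetaLike G x z L) (i : Fin 3) (p : ℕ) (hp : 0 < p) (hp' : p < L i) (v : V)
    (hv : G.Adj (x i p) v) : v = x i (p - 1) ∨ v = x i (p + 1) := by
  rcases h.inv _ _ hv with ⟨j, q, hq, ⟨e, rfl⟩ | ⟨rfl, e⟩⟩ | ⟨e, rfl⟩ | ⟨rfl, e⟩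
  · rcases h.inj _ _ _ _ hp'.le hq.le e with ⟨rfl, rfl⟩ | h' | h'
    · exact Or.inr rfl
    · omega
    · omega
  · rcases h.inj _ _ _ _ hp'.le hq e with ⟨rfl, rfl⟩ | h' | h'
    · exact Or.inl rfl
    · omega
    · omega
  · rcases h.inj _ _ _ _ hp'.le (Nat.zero_le _) e with ⟨rfl, rfl⟩ | h' | h' <;> omega
  · exact absurd e (h.nz _ _)

lemma nbr_zero (h : ThetaLike G x z L) (v : V)
    (hv : G.Adj (x 0 0) v) : v = z ∨ ∃ i, v = x i 1 := by
  rcases h.inv _ _ hv with ⟨j, q, hq, ⟨e, rfl⟩ | ⟨rfl, e⟩⟩ | ⟨e, rfl⟩ | ⟨rfl, e⟩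
  · have := h.pos 0
    rcases h.inj _ _ _ _ (Nat.zero_le _) hq.le e with ⟨rfl, rfl⟩ | ⟨_, rfl⟩ | h'
    · exact Or.inr ⟨_, rfl⟩
    · exact Or.inr ⟨_, rfl⟩
    · omega
  · have := h.pos 0
    rcases h.inj _ _ _ _ (Nat.zero_le _) hq e with h' | h' | h' <;> omega
  · exact Or.inl rfl
  · exact absurd e (h.nz _ _)

lemma nbr_last (h : ThetaLike G x z L) (i : Fin 3) (v : V)
    (hv : G.Adj (x i (L i)) v) : ∃ i, v = x i (L i - 1) := by
  have := h.pos i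
  rcases h.inv _ _ hv with ⟨j, q, hq, ⟨e, rfl⟩ | ⟨rfl, e⟩⟩ | ⟨e, rfl⟩ | ⟨rfl, e⟩
  · rcases h.inj _ _ _ _ le_rfl hq.le e with ⟨rfl, rfl⟩ | h' | h' <;> omega
  · rcases h.inj _ _ _ _ le_rfl hq e with ⟨rfl, h'⟩ | h' | h'
    · exact ⟨i, by rw [h']; rfl⟩
    · omega
    · exact ⟨j, by rw [← h'.2]; rfl⟩
  · have := h.pos 0
    rcases h.inj _ _ _ _ le_rfl (Nat.zero_le _) e with ⟨rfl, h'⟩ | h' | h' <;> omega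
  · exact absurd e (h.nz _ _)

lemma nbr_z (h : ThetaLike G x z L) (v : V) (hv : G.Adj z v) : v = x 0 0 := by
  rcases h.inv _ _ hv with ⟨j, q, hq, ⟨e, rfl⟩ | ⟨rfl, e⟩⟩ | ⟨e, rfl⟩ | ⟨rfl, e⟩
  · exact absurd e.symm (h.nz _ _)
  · exact absurd e.symm (h.nz _ _)
  · exact e
  · rfl

lemma cycle_length (h : ThetaLike G x z L) {m : ℕ} (hm : ∀ i, m ≤ L i) {u : V}
    (w : G.Walk u u) (hw : w.IsCycle) : 2 * m ≤ w.length := by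
  classical
  have hnb : ∀ v ∈ w.support, ∃ a b, a ≠ b ∧ G.Adj v a ∧ G.Adj v b ∧
      a ∈ w.support ∧ b ∈ w.support := by
    intro v hv
    obtain ⟨a, b, hab, e⟩ := Set.ncard_eq_two.1 (hw.ncard_neighborSet_toSubgraph_eq_two hv)
    have ha : w.toSubgraph.Adj v a := by
      rw [← Subgraph.mem_neighborSet, e]; simp
    have hb : w.toSubgraph.Adj v b := by
      rw [← Subgraph.mem_neighborSet, e]; simp
    exact ⟨a, b, hab, ha.adj_sub, hb.adj_sub,
      w.mem_verts_toSubgraph.1 ha.snd_mem, w.mem_verts_toSubgraph.1 hb.snd_mem⟩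
  have hz : z ∉ w.support := by
    intro hv
    obtain ⟨a, b, hab, ha, hb, -⟩ := hnb z hv
    exact hab ((h.nbr_z a ha).trans (h.nbr_z b hb).symm)
  have hmid : ∀ i p, 0 < p → p < L i → x i p ∈ w.support →
      x i (p - 1) ∈ w.support ∧ x i (p + 1) ∈ w.support := by
    intro i p hp hp' hv
    obtain ⟨a, b, hab, ha, hb, ha', hb'⟩ := hnb _ hv
    rcases h.nbr_int i p hp hp' a ha with rfl | rfl <;>
      rcases h.nbr_int i p hp hp' b hb with rfl | rfl
    · exact absurd rfl hab
    · exact ⟨ha', hb'⟩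
    · exact ⟨hb', ha'⟩
    · exact absurd rfl hab
  have hdown : ∀ i p, p < L i → x i p ∈ w.support → x 0 0 ∈ w.support := by
    intro i p
    induction p with
    | zero => intro _ hv; rw [h.e0 0 i]; exact hv
    | succ p ih => intro hp hv; exact ih (by omega) (hmid i (p + 1) (by omega) hp hv).1
  have h0 : x 0 0 ∈ w.support := by
    rcases h.surj u with e | ⟨i, p, hp, e⟩
    · exact absurd (e ▸ w.start_mem_support) hz
    · have hu : x i p ∈ w.support := by rw [e]; exact w.start_mem_support
      rcases hp.lt_or_eq with hp | rfl
      · exact hdown i p hp hu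
      · obtain ⟨a, b, hab, ha, hb, ha', hb'⟩ := hnb _ hu
        obtain ⟨j, rfl⟩ := h.nbr_last i a ha
        have := h.pos j
        exact hdown j _ (by omega) ha'
  have hup : ∀ i p, x i 1 ∈ w.support → p < L i → x i (p + 1) ∈ w.support := by
    intro i p h1
    induction p with
    | zero => intro _; exact h1
    | succ p ih => intro hp; exact (hmid i (p + 1) (by omega) hp (ih (by omega))).2
  obtain ⟨a, b, hab, ha, hb, ha', hb'⟩ := hnb _ h0
  rcases h.nbr_zero a ha with rfl | ⟨i, rfl⟩
  · exact absurd ha' hz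
  rcases h.nbr_zero b hb with rfl | ⟨j, rfl⟩
  · exact absurd hb' hz
  have hij : i ≠ j := fun e => hab (by rw [e])
  have hsub : ∀ v ∈ w.support, v ∈ w.support.tail := by
    intro v hv
    rw [← Walk.cons_tail_support, List.mem_cons] at hv
    rcases hv with rfl | hv
    · exact Walk.end_mem_tail_support hw.not_nil
    · exact hv
  let F : Fin m ⊕ Fin m → V := fun s => match s with
    | Sum.inl p => x i p
    | Sum.inr p => x j (p + 1)
  have hF : ∀ s, F s ∈ w.support.tail.toFinset := by
    intro s
    rw [List.mem_toFinset]
    apply hsub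
    have := hm i
    have := hm j
    rcases s with ⟨p, hp⟩ | ⟨p, hp⟩
    · change x i p ∈ _
      rcases p with _ | p
      · rw [h.e0 i 0]; exact h0
      · exact hup i p ha' (by omega)
    · exact hup j p hb' (by omega)
  have hFi : Function.Injective F := by
    have := hm i
    have := hm j
    rintro (⟨p, hp⟩ | ⟨p, hp⟩) (⟨q, hq⟩ | ⟨q, hq⟩) e
    · have := h.inj i i p q (by omega) (by omega) e
      simp; omega
    · rcases h.inj i j p (q + 1) (by omega) (by omega) e with h' | h' | h'
      · exact absurd h'.1 hij
      · omega
      · omega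
    · rcases h.inj j i (p + 1) q (by omega) (by omega) e with h' | h' | h'
      · exact absurd h'.1.symm hij
      · omega
      · omega
    · have := h.inj j j (p + 1) (q + 1) (by omega) (by omega) e
      simp; omega
  have hc : Fintype.card (Fin m ⊕ Fin m) ≤ w.support.tail.toFinset.card := by
    rw [← Finset.card_univ]
    exact Finset.card_le_card_of_injOn F (fun s _ => hF s) hFi.injOn
  have hl := List.toFinset_card_le w.support.tail
  simp only [Fintype.card_sum, Fintype.card_fin, List.length_tail, Walk.length_support] at hc hl
  omega

lemma egirth_le (h : ThetaLike G x z L) {k : ℕ}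
    (l0 : L 0 = 2 * k) (l1 : L 1 = 2 * k) (hk : 0 < k) : G.egirth ≤ ((4 * k : ℕ) : ℕ∞) := by
  let F : Fin (4 * k) → V := fun t => if (t : ℕ) ≤ 2 * k then x 0 t else x 1 (4 * k - t)
  have hFi : Function.Injective F := by
    rintro ⟨s, hs⟩ ⟨t, ht⟩ e
    simp only [F] at e
    simp only [Fin.mk.injEq]
    split_ifs at e with h1 h2 h2
    · have := h.inj _ _ _ _ (by omega) (by omega) e
      omega
    · rcases h.inj _ _ _ _ (by omega) (by omega) e with h' | h' | h'
      · exact absurd h'.1 (by decide)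
      · omega
      · omega
    · rcases h.inj _ _ _ _ (by omega) (by omega) e with h' | h' | h'
      · exact absurd h'.1 (by decide)
      · omega
      · omega
    · have := h.inj _ _ _ _ (by omega) (by omega) e
      omega
  have hstep : ∀ s t : Fin (4 * k), (t - s).val = 1 → G.Adj (F s) (F t) := by
    rintro ⟨s, hs⟩ ⟨t, ht⟩ e
    have hst : t = s + 1 ∨ (s = 4 * k - 1 ∧ t = 0) := by
      rw [Fin.sub_def] at e
      simp only at e
      by_cases hlt : s ≤ t
      · rw [show 4 * k - s + t = (t - s) + 4 * k by omega, Nat.add_mod_right,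
          Nat.mod_eq_of_lt (by omega)] at e
        omega
      · rw [Nat.mod_eq_of_lt (by omega)] at e
        omega
    simp only [F]
    rcases hst with rfl | ⟨rfl, rfl⟩
    · by_cases h1 : s + 1 ≤ 2 * k
      · rw [if_pos (by omega), if_pos h1]
        exact h.adj 0 s (by omega)
      · by_cases h2 : s ≤ 2 * k
        · have : s = 2 * k := by omega
          subst this
          rw [if_pos h2, if_neg h1]
          have e1 := h.e1 0 1
          rw [l0, l1] at e1
          rw [e1]
          have := h.adj 1 (4 * k - (2 * k + 1)) (by omega)
          rw [show 4 * k - (2 * k + 1) + 1 = 2 * k by omega] at this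
          exact this.symm
        · rw [if_neg h2, if_neg h1]
          have := h.adj 1 (4 * k - (s + 1)) (by omega)
          rw [show 4 * k - (s + 1) + 1 = 4 * k - s by omega] at this
          exact this.symm
    · rw [if_neg (by omega), if_pos (by omega), show 4 * k - (4 * k - 1) = 1 by omega, h.e0 0 1]
      exact (h.adj 1 0 (by omega)).symm
  have hcont : (cycleGraph (4 * k)).IsContained G := by
    refine ⟨⟨⟨F, ?_⟩, hFi⟩⟩
    intro s t hst
    rcases cycleGraph_adj'.1 hst with e | e
    · exact (hstep _ _ e).symm
    · exact hstep _ _ e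
  obtain ⟨v, p, hp, hl⟩ := (cycleGraph_isContained_iff (by omega)).1 hcont
  rw [← hl]
  exact egirth_le_length hp

end ThetaLike

/-- The vertex at position `p` on the `i`-th path. -/
def thetaVertex (a b c : ℕ) (i : Fin 3) (p : ℕ) :
    (Fin 2 ⊕ (Fin (a - 1) ⊕ Fin (b - 1) ⊕ Fin (c - 1))) ⊕ Unit :=
  if p = 0 then Sum.inl (Sum.inl 0) else
  match i with
  | 0 => if h : p - 1 < a - 1 then Sum.inl (Sum.inr (Sum.inl ⟨p - 1, h⟩))
      else Sum.inl (Sum.inl 1)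
  | 1 => if h : p - 1 < b - 1 then Sum.inl (Sum.inr (Sum.inr (Sum.inl ⟨p - 1, h⟩)))
      else Sum.inl (Sum.inl 1)
  | 2 => if h : p - 1 < c - 1 then Sum.inl (Sum.inr (Sum.inr (Sum.inr ⟨p - 1, h⟩)))
      else Sum.inl (Sum.inl 1)

lemma thetaVertex_inj (a b c : ℕ) (ha : 2 ≤ a) (hb : 2 ≤ b) (hc : 2 ≤ c) (i j : Fin 3) (p q : ℕ)
    (hp : p ≤ ![a, b, c] i) (hq : q ≤ ![a, b, c] j)
    (e : thetaVertex a b c i p = thetaVertex a b c j q) :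
    (i = j ∧ p = q) ∨ (p = 0 ∧ q = 0) ∨ (p = ![a, b, c] i ∧ q = ![a, b, c] j) := by
  unfold thetaVertex at e
  fin_cases i <;> fin_cases j <;> simp at hp hq e ⊢ <;> split_ifs at e <;> simp at e <;> omega

lemma thetaLike_theta (a b c : ℕ) (ha : 2 ≤ a) (hb : 2 ≤ b) (hc : 2 ≤ c) :
    ThetaLike (thetaPlusPendant a b c) (thetaVertex a b c) (Sum.inr ()) ![a, b, c] where
  pos := by intro i; fin_cases i <;> simpa
  e0 := by intro i j; simp [thetaVertex]
  e1 := by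
    have : ∀ i, thetaVertex a b c i (![a, b, c] i) = Sum.inl (Sum.inl 1) := by
      intro i
      fin_cases i <;> simp [thetaVertex] <;> omega
    intro i j
    rw [this, this]
  inj := thetaVertex_inj a b c ha hb hc
  nz := by
    intro i p
    unfold thetaVertex
    fin_cases i <;> simp <;> split_ifs <;> simp
  surj := by
    rintro ((i | p | p | p) | _)
    · right
      fin_cases i
      · exact ⟨0, 0, by simp, by simp [thetaVertex]⟩
      · refine ⟨0, a, by simp, ?_⟩
        simp [thetaVertex]; omega
    · right
      refine ⟨0, p + 1, ?_, ?_⟩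
      · have := p.2; simp; omega
      · simp [thetaVertex]
    · right
      refine ⟨1, p + 1, ?_, ?_⟩
      · have := p.2; simp; omega
      · simp [thetaVertex]
    · right
      refine ⟨2, p + 1, ?_, ?_⟩
      · have := p.2; simp; omega
      · simp [thetaVertex]
    · left; rfl
  adj := by
    intro i p hp
    unfold thetaVertex thetaPlusPendant thetaGraph
    fin_cases i <;> simp at hp ⊢ <;> split_ifs <;> simp <;> omega
  adjz := by simp [thetaVertex, thetaPlusPendant]
  inv := by
    have key : ∀ x y, (thetaGraph a b c).Adj x y → ∃ i p, p < ![a, b, c] i ∧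
        ((Sum.inl x = thetaVertex a b c i p ∧ Sum.inl y = thetaVertex a b c i (p + 1)) ∨
         (Sum.inl y = thetaVertex a b c i p ∧ Sum.inl x = thetaVertex a b c i (p + 1))) := by
      have one : ∀ (j : Fin 3) (s : Fin 2) (q M : ℕ) (v : _), 2 ≤ M → ![a, b, c] j = M →
          q < M - 1 → thetaVertex a b c j (q + 1) = v →
          ((s : ℕ) = 0 ∧ q = 0) ∨ ((s : ℕ) = 1 ∧ q = M - 2) →
          ∃ i p, p < ![a, b, c] i ∧
            ((Sum.inl (Sum.inl s) = thetaVertex a b c i p ∧ v = thetaVertex a b c i (p + 1)) ∨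
             (v = thetaVertex a b c i p ∧
               Sum.inl (Sum.inl s) = thetaVertex a b c i (p + 1))) := by
        rintro j s q M v hM hj hq rfl (⟨hs, rfl⟩ | ⟨hs, rfl⟩)
        · refine ⟨j, 0, by omega, Or.inl ⟨?_, rfl⟩⟩
          have : s = 0 := Fin.ext hs
          simp [thetaVertex, this]
        · refine ⟨j, M - 2 + 1, by omega, Or.inr ⟨rfl, ?_⟩⟩
          have : s = 1 := Fin.ext hs
          subst this
          fin_cases j <;> simp at hj <;> subst hj <;> simp [thetaVertex] <;> omega
      have two : ∀ (j : Fin 3) (p q M : ℕ) (u v : _), ![a, b, c] j = M →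
          p < M - 1 → q < M - 1 → thetaVertex a b c j (p + 1) = u →
          thetaVertex a b c j (q + 1) = v → (q = p + 1 ∨ p = q + 1) →
          ∃ i p, p < ![a, b, c] i ∧
            ((u = thetaVertex a b c i p ∧ v = thetaVertex a b c i (p + 1)) ∨
             (v = thetaVertex a b c i p ∧ u = thetaVertex a b c i (p + 1))) := by
        rintro j p q M u v hj hp hq rfl rfl (rfl | rfl)
        · exact ⟨j, p + 1, by omega, Or.inl ⟨rfl, rfl⟩⟩
        · exact ⟨j, q + 1, by omega, Or.inr ⟨rfl, rfl⟩⟩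
      have swap : ∀ u v : (Fin 2 ⊕ (Fin (a - 1) ⊕ Fin (b - 1) ⊕ Fin (c - 1))) ⊕ Unit,
          (∃ i p, p < ![a, b, c] i ∧
            ((u = thetaVertex a b c i p ∧ v = thetaVertex a b c i (p + 1)) ∨
             (v = thetaVertex a b c i p ∧ u = thetaVertex a b c i (p + 1)))) →
          (∃ i p, p < ![a, b, c] i ∧
            ((v = thetaVertex a b c i p ∧ u = thetaVertex a b c i (p + 1)) ∨
             (u = thetaVertex a b c i p ∧ v = thetaVertex a b c i (p + 1)))) := by
        rintro u v ⟨i, p, hp, h⟩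
        exact ⟨i, p, hp, h.symm⟩
      rintro (s | p | p | p) (t | q | q | q) hxy <;>
        simp only [thetaGraph, SimpleGraph.fromRel_adj, or_false, false_or, and_false] at hxy
      · exact one 0 s q a _ ha rfl q.2 (by simp [thetaVertex]) hxy.2
      · exact one 1 s q b _ hb rfl q.2 (by simp [thetaVertex]) hxy.2
      · exact one 2 s q c _ hc rfl q.2 (by simp [thetaVertex]) hxy.2
      · exact swap _ _ (one 0 t p a _ ha rfl p.2 (by simp [thetaVertex]) hxy.2)
      · exact two 0 p q a _ _ rfl p.2 q.2 (by simp [thetaVertex]) (by simp [thetaVertex]) hxy.2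
      · exact swap _ _ (one 1 t p b _ hb rfl p.2 (by simp [thetaVertex]) hxy.2)
      · exact two 1 p q b _ _ rfl p.2 q.2 (by simp [thetaVertex]) (by simp [thetaVertex]) hxy.2
      · exact swap _ _ (one 2 t p c _ hc rfl p.2 (by simp [thetaVertex]) hxy.2)
      · exact two 2 p q c _ _ rfl p.2 q.2 (by simp [thetaVertex]) (by simp [thetaVertex]) hxy.2
    rintro (x | _) (y | _) hxy
    · left
      have : (thetaGraph a b c).Adj x y := by
        simp [thetaPlusPendant] at hxy
        rcases hxy.2 with h | h
        · exact h
        · exact h.symm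
      exact key x y this
    · right; left
      rcases x with i | x
      · simp [thetaPlusPendant] at hxy
        simp [thetaVertex, hxy]
      · simp [thetaPlusPendant] at hxy
    · right; right
      rcases y with i | x
      · simp [thetaPlusPendant] at hxy
        simp [thetaVertex, hxy]
      · simp [thetaPlusPendant] at hxy
    · simp at hxy

theorem exists_almostSelfCentered_girth_eq (n : ℕ) (h6 : 6 ≤ n) (hev : Even n) :
    IsAlmostSelfCentered (thetaPlusPendant (2 * (n / 6)) (2 * (n / 6)) (n - 4 * (n / 6))) ∧
      Fintype.card ((Fin 2 ⊕ (Fin (2 * (n / 6) - 1) ⊕ Fin (2 * (n / 6) - 1) ⊕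
        Fin (n - 4 * (n / 6) - 1))) ⊕ Unit) = n ∧
      (thetaPlusPendant (2 * (n / 6)) (2 * (n / 6)) (n - 4 * (n / 6))).egirth =
        ((4 * (n / 6) : ℕ) : ℕ∞) := by
  have hk : 0 < n / 6 := by omega
  obtain ⟨m, hm⟩ := hev
  have hT := thetaLike_theta (2 * (n / 6)) (2 * (n / 6)) (n - 4 * (n / 6))
    (by omega) (by omega) (by omega)
  have hr : n - 4 * (n / 6) = 2 * (n / 6) + 2 * (m - 3 * (n / 6)) := by omega
  refine ⟨hT.almostSelfCentered (k := n / 6) (r := m - 3 * (n / 6)) (by simp) (by simp)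
    (by simp; omega) hk, ?_, ?_⟩
  · simp only [Fintype.card_sum, Fintype.card_fin, Fintype.card_unit]
    omega
  · apply le_antisymm
    · exact hT.egirth_le (by simp) (by simp) hk
    · rw [le_egirth]
      intro v w hw
      have := hT.cycle_length (m := 2 * (n / 6)) (by
        intro i; fin_cases i <;> simp; omega) w hw
      exact_mod_cast (by omega : 4 * (n / 6) ≤ w.length)
end
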